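/- Let G^{A,B} be a biconed graph with h-vector (h_0, h_1, …, h_d) of its graphic matroid. Then for every i, h_i equals the number of 2-edge-rooted forests of G^{A,B}_red of degree i. -/

import Mathlib

/-!
Formalization scaffold for "h-vectors of graphic matroids of biconed graphs".

A graph `G` (loops and parallel edges allowed) with vertex set `A ∪ B` is
modelled by an abstract finite edge type `E` with an endpoint map
`ends : E → Sym2 (Fin m ⊕ₗ Fin n)`, where `A = Fin m = {1,…,m}`,
`Ā = B \ A = Fin n = {1̄,…,n̄}` and the finset `S ⊆ Fin m` records `A ∩ B`
(so `B = S ∪ Ā`).  The biconing `G^{A,B}` adds the two vertices `0` and `0̄`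
and the edges `00̄`, `0a (a ∈ A)` and `0̄b (b ∈ B)`.
-/

namespace BiconedPaper

noncomputable section
open scoped Classical

/-! ### Walks in multigraphs presented by an endpoint map -/

/-- A walk in the multigraph with edge set `ε` and endpoint map `ends`. -/
inductive MWalk {ε ν : Type} (ends : ε → Sym2 ν) : ν → ν → Type
  | nil (u : ν) : MWalk ends u u
  | cons {u w : ν} (e : ε) (v : ν) (h : ends e = s(u, v)) (p : MWalk ends v w) :
      MWalk ends u w

namespace MWalk

variable {ε ν : Type} {ends : ε → Sym2 ν}

/-- The list of edges traversed by a walk. -/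
def edges : ∀ {u v : ν}, MWalk ends u v → List ε
  | _, _, nil _ => []
  | _, _, cons e _ _ p => e :: p.edges

/-- The list of vertices visited by a walk. -/
def support : ∀ {u v : ν}, MWalk ends u v → List ν
  | u, _, nil _ => [u]
  | u, _, cons _ _ _ p => u :: p.support

/-- A walk is a path if it visits no vertex twice. -/
def IsPath {u v : ν} (p : MWalk ends u v) : Prop := p.support.Nodup

/-- All edges of the walk belong to the edge set `F`. -/
def edgesIn {u v : ν} (p : MWalk ends u v) (F : Finset ε) : Prop :=
  ∀ e ∈ p.edges, e ∈ F

/-- The number of "bridging" edges traversed by a walk, i.e. steps whose two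
endpoints lie on different sides according to `sideF`. -/
def bridgeCount (sideF : ν → Bool) : ∀ {u v : ν}, MWalk ends u v → ℕ
  | _, _, nil _ => 0
  | u, _, cons _ v' _ p => (if sideF u = sideF v' then 0 else 1) + p.bridgeCount sideF

end MWalk

/-- `u` and `v` are joined by a walk all of whose edges lie in `F`. -/
def Reachable {ε ν : Type} (ends : ε → Sym2 ν) (F : Finset ε) (u v : ν) : Prop :=
  ∃ p : MWalk ends u v, p.edgesIn F

/-- An edge set is acyclic (a forest) iff removing any one of its edges
disconnects the endpoints of that edge.  (In particular no loops and no
parallel pairs.) -/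
def IsAcyclic {ε ν : Type} [DecidableEq ε] (ends : ε → Sym2 ν) (F : Finset ε) : Prop :=
  ∀ e ∈ F, ∀ u v : ν, ends e = s(u, v) → ¬ Reachable ends (F.erase e) u v

/-- A spanning tree: an acyclic edge set connecting every pair of vertices. -/
def IsSpanningTree {ε ν : Type} [DecidableEq ε] (ends : ε → Sym2 ν) (T : Finset ε) : Prop :=
  IsAcyclic ends T ∧ ∀ u v : ν, Reachable ends T u v

/-! ### Biconed graphs -/

/-- The data of a biconed graph `G^{A,B}`:  the graph `G` has vertex set
`A ∪ B` with `A = Fin m`, `Ā = B \ A = Fin n`, `A ∩ B = S`, and abstract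
edge set `E` (so loops and parallel edges are allowed). -/
structure BiconedGraph where
  m : ℕ
  n : ℕ
  E : Type
  fintypeE : Fintype E
  decEqE : DecidableEq E
  ends : E → Sym2 (Fin m ⊕ₗ Fin n)
  S : Finset (Fin m)

namespace BiconedGraph

variable (P : BiconedGraph)

instance : Fintype P.E := P.fintypeE
instance : DecidableEq P.E := P.decEqE

/-- The vertices of `G`, linearly ordered `1 < ⋯ < m < 1̄ < ⋯ < n̄`. -/
abbrev VG := Fin P.m ⊕ₗ Fin P.n

/-- The vertices of `G^{A,B}_red`:  `⊥` is the vertex `0̄`, ordered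
`0̄ < 1 < ⋯ < m < 1̄ < ⋯ < n̄`. -/
abbrev Vred := WithBot P.VG

/-- The vertices of `G^{A,B}`: `⊥` is `0`, ordered `0 < 0̄ < 1 < ⋯ < n̄`. -/
abbrev W := WithBot P.Vred

/-- The vertex `a ∈ A`. -/
def aVert (a : Fin P.m) : P.VG := toLex (Sum.inl a)
/-- The vertex `b ∈ Ā`. -/
def bVert (b : Fin P.n) : P.VG := toLex (Sum.inr b)
/-- Inclusion of the vertices of `G` into those of `G^{A,B}_red`. -/
def liftV (x : P.VG) : P.Vred := (x : WithBot P.VG)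
/-- Inclusion of the vertices of `G^{A,B}_red` into those of `G^{A,B}`. -/
def liftW (x : P.Vred) : P.W := (x : WithBot P.Vred)

/-- The edges of the biconed graph `G^{A,B}`:  the edge `00̄`, the coning
edges `0a (a ∈ A)`, `0̄b (b ∈ Ā)`, `0̄a (a ∈ A ∩ B)`, and the edges of `G`. -/
abbrev EB := Unit ⊕ (Fin P.m ⊕ (Fin P.n ⊕ ({a : Fin P.m // a ∈ P.S} ⊕ P.E)))

/-- The edge `00̄`. -/
abbrev e00 : P.EB := Sum.inl ()
/-- The coning edge `0a`, `a ∈ A`. -/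
abbrev eA (a : Fin P.m) : P.EB := Sum.inr (Sum.inl a)
/-- The coning edge `0̄b`, `b ∈ Ā`. -/
abbrev eB (b : Fin P.n) : P.EB := Sum.inr (Sum.inr (Sum.inl b))
/-- The coning edge `0̄a`, `a ∈ A ∩ B`. -/
abbrev eS (a : {a : Fin P.m // a ∈ P.S}) : P.EB := Sum.inr (Sum.inr (Sum.inr (Sum.inl a)))
/-- An original edge of `G`. -/
abbrev eG (e : P.E) : P.EB := Sum.inr (Sum.inr (Sum.inr (Sum.inr e)))

/-- The endpoint map of `G^{A,B}`. -/
def endsB : P.EB → Sym2 P.W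
  | Sum.inl _ => s((⊥ : P.W), P.liftW ⊥)
  | Sum.inr (Sum.inl a) => s((⊥ : P.W), P.liftW (P.liftV (P.aVert a)))
  | Sum.inr (Sum.inr (Sum.inl b)) => s(P.liftW ⊥, P.liftW (P.liftV (P.bVert b)))
  | Sum.inr (Sum.inr (Sum.inr (Sum.inl a))) => s(P.liftW ⊥, P.liftW (P.liftV (P.aVert a.1)))
  | Sum.inr (Sum.inr (Sum.inr (Sum.inr e))) => (P.ends e).map fun x => P.liftW (P.liftV x)

/-- The spanning tree `T₀`, consisting of `00̄`, the edges `0a (a ∈ A)` and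
the edges `0̄b (b ∈ Ā)`. -/
def T0 : Finset P.EB :=
  Finset.univ.filter fun e => match e with
    | Sum.inl _ => True
    | Sum.inr (Sum.inl _) => True
    | Sum.inr (Sum.inr (Sum.inl _)) => True
    | _ => False

/-- The edges of `G^{A,B}_red` (delete the edges of `T₀` and the vertex `0`):
the edges `0̄a (a ∈ A ∩ B)` together with the edges of `G`. -/
abbrev Ered := {a : Fin P.m // a ∈ P.S} ⊕ P.E

/-- The endpoint map of `G^{A,B}_red`; `⊥` is the vertex `0̄`. -/
def endsRed : P.Ered → Sym2 P.Vred
  | Sum.inl a => s((⊥ : P.Vred), P.liftV (P.aVert a.1))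
  | Sum.inr e => (P.ends e).map P.liftV

/-- Inclusion of the edges of `G^{A,B}_red` into those of `G^{A,B}`. -/
def redToEB : P.Ered → P.EB
  | Sum.inl a => P.eS a
  | Sum.inr e => P.eG e

/-- The edge set `T \ T₀` of `T`, viewed inside `G^{A,B}_red`. -/
def redOf (T : Finset P.EB) : Finset P.Ered :=
  Finset.univ.filter fun e => P.redToEB e ∈ T

/-- `true` on the vertices of `A`, `false` on the vertices of `Ā ∪ {0̄}`. -/
def side : P.Vred → Bool :=
  WithBot.recBotCoe false fun x => Sum.elim (fun _ => true) (fun _ => false) (ofLex x)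

/-- The vertex lies in `A`. -/
def InA (v : P.Vred) : Prop := ∃ a : Fin P.m, v = P.liftV (P.aVert a)

/-- An edge of `G^{A,B}_red` is bridging if it joins a vertex of `A` to a
vertex of `Ā ∪ {0̄}`. -/
def BridgingE (e : P.Ered) : Prop :=
  ∃ u v : P.Vred, P.endsRed e = s(u, v) ∧ P.side u ≠ P.side v

/-! ### 2-edge-rooted forests -/

/-- The underlying edge set `F` of the multiset of edges given by the
multiplicity function `mult` (an edge `e` carries `mult e - 1` edge roots). -/
def mSupport (mult : P.Ered → ℕ) : Finset P.Ered :=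
  Finset.univ.filter fun e => mult e ≠ 0

/-- The degree of the multiset of edges given by `mult`. -/
def deg (mult : P.Ered → ℕ) : ℕ := ∑ e : P.Ered, mult e

/-- Edge `e` meets the connected component of `v` in the edge set `F`. -/
def Touches (F : Finset P.Ered) (v : P.Vred) (e : P.Ered) : Prop :=
  ∃ u : P.Vred, u ∈ P.endsRed e ∧ Reachable P.endsRed F v u

/-- The total number of edge roots in the component of `v`. -/
def compEdgeRoots (mult : P.Ered → ℕ) (v : P.Vred) : ℕ :=
  ∑ e ∈ P.mSupport mult, if P.Touches (P.mSupport mult) v e then mult e - 1 else 0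

/-- The component of `v` is `compCount`-edge-rooted:  the number of its edge
roots, plus `1` if it contains the vertex `0̄`. -/
def compCount (mult : P.Ered → ℕ) (v : P.Vred) : ℕ :=
  P.compEdgeRoots mult v +
    if Reachable P.endsRed (P.mSupport mult) v (⊥ : P.Vred) then 1 else 0

/-- Condition (C3) for the `2`-edge-rooted component of `v`:  the unique
shortest path containing both edge roots (resp. the vertex `0̄` and the edge
root, if the component contains `0̄`) has an odd number of bridging edges.
The shortest path containing two edges is the unique path whose first and
last edges are the two rooted edges; if the two edge roots lie on one common
edge (`mult e = 3`) the path is that single edge. -/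
def C3At (mult : P.Ered → ℕ) (v : P.Vred) : Prop :=
  (Reachable P.endsRed (P.mSupport mult) v (⊥ : P.Vred) →
    ∃ (x : P.Vred) (p : MWalk P.endsRed (⊥ : P.Vred) x),
      p.IsPath ∧ p.edgesIn (P.mSupport mult) ∧
      (∃ e, p.edges.getLast? = some e ∧ 2 ≤ mult e) ∧
      Odd (p.bridgeCount P.side)) ∧
  (¬ Reachable P.endsRed (P.mSupport mult) v (⊥ : P.Vred) →
    ∃ (x y : P.Vred) (p : MWalk P.endsRed x y),
      p.IsPath ∧ p.edgesIn (P.mSupport mult) ∧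
      Reachable P.endsRed (P.mSupport mult) v x ∧
      (∃ e, p.edges.head? = some e ∧ 2 ≤ mult e) ∧
      (∃ e, p.edges.getLast? = some e ∧ 2 ≤ mult e) ∧
      (∀ e, p.edges = [e] → mult e = 3) ∧
      Odd (p.bridgeCount P.side))

/-- `mult : Ered → ℕ` is (the multiplicity function of) a 2-edge-rooted
forest of `G^{A,B}_red`:
(C0) its support is a spanning forest;
(C1) at most one component is `2`-edge-rooted;
(C2) every other component is `0`- or `1`-edge-rooted;
(C3) the parity condition on the path joining the two roots. -/
def Is2ERF (mult : P.Ered → ℕ) : Prop :=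
  IsAcyclic P.endsRed (P.mSupport mult) ∧
  (∀ v : P.Vred, P.compCount mult v ≤ 2) ∧
  (∀ u v : P.Vred, P.compCount mult u = 2 → P.compCount mult v = 2 →
    Reachable P.endsRed (P.mSupport mult) u v) ∧
  (∀ v : P.Vred, P.compCount mult v = 2 → P.C3At mult v)

/-! ### Birooted forests -/

/-- `(F, R)` is a birooted forest of `G^{A,B}_red`:  `F` is a spanning forest,
the root set `R` contains `0̄`, every component of `F` contains at least one
root, no component contains three roots, at most one component contains two
roots, and a component with two roots has one root in `A` and the other in
`Ā ∪ {0̄}`. -/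
def IsBirootedForest (F : Finset P.Ered) (R : Set P.Vred) : Prop :=
  IsAcyclic P.endsRed F ∧
  (⊥ : P.Vred) ∈ R ∧
  (∀ v : P.Vred, ∃ r ∈ R, Reachable P.endsRed F v r) ∧
  (∀ r₁ ∈ R, ∀ r₂ ∈ R, ∀ r₃ ∈ R, r₁ ≠ r₂ → r₁ ≠ r₃ → r₂ ≠ r₃ →
    Reachable P.endsRed F r₁ r₂ → Reachable P.endsRed F r₁ r₃ → False) ∧
  (∀ r₁ ∈ R, ∀ r₂ ∈ R, ∀ r₃ ∈ R, ∀ r₄ ∈ R, r₁ ≠ r₂ → r₃ ≠ r₄ →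
    Reachable P.endsRed F r₁ r₂ → Reachable P.endsRed F r₃ r₄ →
    Reachable P.endsRed F r₁ r₃) ∧
  (∀ r₁ ∈ R, ∀ r₂ ∈ R, r₁ ≠ r₂ → Reachable P.endsRed F r₁ r₂ →
    (P.InA r₁ ∧ ¬ P.InA r₂) ∨ (P.InA r₂ ∧ ¬ P.InA r₁))

/-! ### Internal activity and the edge order -/

/-- `e` is internally passive in the spanning tree `T`:  it can be exchanged
for a strictly smaller edge `f` so that the result is again a spanning tree. -/
def InternallyPassive (ord : LinearOrder P.EB) (T : Finset P.EB) (e : P.EB) : Prop :=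
  e ∈ T ∧ ∃ f : P.EB, ord.lt f e ∧ IsSpanningTree P.endsB (insert f (T.erase e))

/-- `e` is internally active in the spanning tree `T`. -/
def InternallyActive (ord : LinearOrder P.EB) (T : Finset P.EB) (e : P.EB) : Prop :=
  e ∈ T ∧ ¬ ∃ f : P.EB, ord.lt f e ∧ IsSpanningTree P.endsB (insert f (T.erase e))

/-- The number of internally passive edges of `T`. -/
def ipCount (ord : LinearOrder P.EB) (T : Finset P.EB) : ℕ :=
  (T.filter fun e => P.InternallyPassive ord T e).card

/-- The smaller endpoint of an edge of `G^{A,B}`. -/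
def endMin (e : P.EB) : P.W := Sym2.lift ⟨fun a b => a ⊓ b, fun a b => inf_comm a b⟩ (P.endsB e)
/-- The larger endpoint of an edge of `G^{A,B}`. -/
def endMax (e : P.EB) : P.W := Sym2.lift ⟨fun a b => a ⊔ b, fun a b => sup_comm a b⟩ (P.endsB e)

/-- The endpoints of an edge, as an ordered pair in the lexicographic square
of the vertex order `0 < 0̄ < 1 < ⋯ < m < 1̄ < ⋯ < n̄`. -/
def lexEnds (e : P.EB) : P.W ×ₗ P.W := toLex (P.endMin e, P.endMax e)

/-- A linear order on the edges of `G^{A,B}` is admissible if it refines the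
lexicographic order on endpoints (so parallel edges are ordered arbitrarily). -/
def AdmissibleOrder (ord : LinearOrder P.EB) : Prop :=
  ∀ e f : P.EB, P.lexEnds e < P.lexEnds f → ord.lt e f

/-- `v` is a connecting vertex of `T`:  `v ∈ A` and `v` is adjacent to `0` in
`T`, or `v ∈ Ā` and `v` is adjacent to `0̄` in `T`. -/
def ConnVertex (T : Finset P.EB) (v : P.Vred) : Prop :=
  (∃ a : Fin P.m, v = P.liftV (P.aVert a) ∧ P.eA a ∈ T) ∨
  (∃ b : Fin P.n, v = P.liftV (P.bVert b) ∧ P.eB b ∈ T)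

/-- `e` is a connecting edge of `T` (an edge `0a`, `a ∈ A`, or `0̄b`, `b ∈ Ā`)
with connecting vertex `v`. -/
def ConnEdge (T : Finset P.EB) (e : P.EB) (v : P.Vred) : Prop :=
  e ∈ T ∧ ((∃ a : Fin P.m, e = P.eA a ∧ v = P.liftV (P.aVert a)) ∨
           (∃ b : Fin P.n, e = P.eB b ∧ v = P.liftV (P.bVert b)))

/-! ### The h-vector -/

/-- `f_{i-1}`:  the number of acyclic edge sets of cardinality `i` in `G^{A,B}`. -/
def numAcyclic (i : ℕ) : ℕ :=
  Nat.card {F : Finset P.EB // IsAcyclic P.endsB F ∧ F.card = i}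

/-- The rank of the graphic matroid of `G^{A,B}`:  `|V| - 1 = m + n + 1`. -/
def d : ℕ := P.m + P.n + 1

/-- `h` is the h-vector of the graphic matroid of `G^{A,B}`:  it satisfies
`Σ_{i=0}^{d} f_{i-1} (t-1)^{d-i} = Σ_{k=0}^{d} h_k t^{d-k}`. -/
def IsHVector (h : ℕ → ℤ) : Prop :=
  ∑ i ∈ Finset.range (P.d + 1),
      Polynomial.C ((P.numAcyclic i : ℤ)) * (Polynomial.X - 1) ^ (P.d - i)
    = ∑ k ∈ Finset.range (P.d + 1), Polynomial.C (h k) * Polynomial.X ^ (P.d - k)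

end BiconedGraph

/-- `(h 0, …, h d)` is a pure O-sequence:  there is a multicomplex `M` of
multisets on a finite ground set (nonempty, closed under sub-multisets), all
of whose inclusion-maximal members have the same cardinality, whose members
all have cardinality at most `d`, and which has exactly `h i` members of
cardinality `i` for every `i ≤ d`. -/
def IsPureOSeq (d : ℕ) (h : ℕ → ℤ) : Prop :=
  ∃ (N : ℕ) (M : Set (Multiset (Fin N))),
    M.Nonempty ∧
    (∀ s ∈ M, ∀ t : Multiset (Fin N), t ≤ s → t ∈ M) ∧
    (∀ s ∈ M, ∀ t ∈ M, (∀ u ∈ M, s ≤ u → u = s) → (∀ u ∈ M, t ≤ u → u = t) →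
      Multiset.card s = Multiset.card t) ∧
    (∀ s ∈ M, Multiset.card s ≤ d) ∧
    (∀ i ≤ d, (Nat.card {s : Multiset (Fin N) // s ∈ M ∧ Multiset.card s = i} : ℤ) = h i)


/-! ### Part 1: generalities on reachability, acyclicity and paths -/

section Graph

variable {ε ν : Type} {ends : ε → Sym2 ν} {F : Finset ε}

theorem reach_refl (u : ν) : Reachable ends F u u :=
  ⟨MWalk.nil u, by simp [MWalk.edgesIn, MWalk.edges]⟩

theorem reach_step {e : ε} {u v w : ν} (he : e ∈ F) (h : ends e = s(u, v))
    (hr : Reachable ends F v w) : Reachable ends F u w := by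
  obtain ⟨p, hp⟩ := hr
  refine ⟨MWalk.cons e v h p, ?_⟩
  intro e' he'
  simp only [MWalk.edges, List.mem_cons] at he'
  rcases he' with rfl | h'
  · exact he
  · exact hp _ h'

theorem reach_edge {e : ε} {u v : ν} (he : e ∈ F) (h : ends e = s(u, v)) :
    Reachable ends F u v := reach_step he h (reach_refl v)

theorem reach_induct {u v : ν} (h : Reachable ends F u v) (P : ν → Prop)
    (hP : ∀ a b e, e ∈ F → ends e = s(a, b) → P a → P b) (hu : P u) : P v := by
  obtain ⟨p, hp⟩ := h
  induction p with
  | nil u => exact hu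
  | cons e w h q ih =>
    exact ih (hP _ _ e (hp e (by simp [MWalk.edges])) h hu)
      (fun e' he' => hp e' (by simp [MWalk.edges, he']))

theorem reach_trans {u v w : ν} (h : Reachable ends F u v) (h' : Reachable ends F v w) :
    Reachable ends F u w := by
  obtain ⟨p, hp⟩ := h
  induction p with
  | nil u => exact h'
  | cons e w h q ih =>
    refine reach_step (hp e (by simp [MWalk.edges])) h
      (ih h' (fun e' he' => hp e' (by simp [MWalk.edges, he'])))

theorem reach_symm {u v : ν} (h : Reachable ends F u v) : Reachable ends F v u := by
  refine reach_induct h (fun x => Reachable ends F x u) ?_ (reach_refl u)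
  intro a b e he hab ha
  exact reach_step he (by rw [hab, Sym2.eq_swap]) ha

theorem reach_mono {F' : Finset ε} (hF : F ⊆ F') {u v : ν} (h : Reachable ends F u v) :
    Reachable ends F' u v := by
  obtain ⟨p, hp⟩ := h
  exact ⟨p, fun e he => hF (hp e he)⟩

/-- Endpoints of a single edge of `F` are reachable from one another. -/
theorem reach_of_mem {e : ε} (he : e ∈ F) {a b : ν} (ha : a ∈ ends e) (hb : b ∈ ends e) :
    Reachable ends F a b := by
  obtain ⟨c, hc⟩ := ha
  rw [hc, Sym2.mem_iff] at hb
  rcases hb with rfl | rfl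
  · exact reach_refl _
  · exact reach_edge he hc

theorem reach_insert [DecidableEq ε] {e : ε} {a b : ν} (he : ends e = s(a, b)) {u v : ν} :
    Reachable ends (insert e F) u v ↔ Reachable ends F u v ∨
      (Reachable ends F u a ∧ Reachable ends F b v) ∨
      (Reachable ends F u b ∧ Reachable ends F a v) := by
  constructor
  · intro h
    refine reach_induct h (fun v => Reachable ends F u v ∨
      (Reachable ends F u a ∧ Reachable ends F b v) ∨
      (Reachable ends F u b ∧ Reachable ends F a v)) ?_ (Or.inl (reach_refl u))
    intro x y f hf hxy hx
    rw [Finset.mem_insert] at hf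
    rcases hf with rfl | hf
    · rw [he, Sym2.eq_iff] at hxy
      rcases hxy with ⟨rfl, rfl⟩ | ⟨rfl, rfl⟩
      · rcases hx with hx | ⟨h1, h2⟩ | ⟨h1, h2⟩
        · exact Or.inr (Or.inl ⟨hx, reach_refl _⟩)
        · exact Or.inr (Or.inl ⟨h1, reach_refl _⟩)
        · exact Or.inl h1
      · rcases hx with hx | ⟨h1, h2⟩ | ⟨h1, h2⟩
        · exact Or.inr (Or.inr ⟨hx, reach_refl _⟩)
        · exact Or.inl h1
        · exact Or.inr (Or.inr ⟨h1, reach_refl _⟩)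
    · have := reach_edge hf hxy
      rcases hx with hx | ⟨h1, h2⟩ | ⟨h1, h2⟩
      · exact Or.inl (reach_trans hx this)
      · exact Or.inr (Or.inl ⟨h1, reach_trans h2 this⟩)
      · exact Or.inr (Or.inr ⟨h1, reach_trans h2 this⟩)
  · have hs : F ⊆ insert e F := Finset.subset_insert _ _
    have hab : Reachable ends (insert e F) a b := reach_edge (Finset.mem_insert_self _ _) he
    rintro (h | ⟨h1, h2⟩ | ⟨h1, h2⟩)
    · exact reach_mono hs h
    · exact reach_trans (reach_mono hs h1) (reach_trans hab (reach_mono hs h2))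
    · exact reach_trans (reach_mono hs h1) (reach_trans (reach_symm hab) (reach_mono hs h2))

theorem acyc_mono [DecidableEq ε] {F' : Finset ε} (hF : F ⊆ F') (h : IsAcyclic ends F') :
    IsAcyclic ends F := fun e he u v huv hr =>
  h e (hF he) u v huv (reach_mono (Finset.erase_subset_erase e hF) hr)

theorem acyc_insert [DecidableEq ε] {e : ε} (hne : e ∉ F) {a b : ν} (he : ends e = s(a, b)) :
    IsAcyclic ends (insert e F) ↔ IsAcyclic ends F ∧ ¬ Reachable ends F a b := by
  constructor
  · intro h
    refine ⟨acyc_mono (Finset.subset_insert _ _) h, ?_⟩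
    have := h e (Finset.mem_insert_self _ _) a b he
    rwa [Finset.erase_insert hne] at this
  · rintro ⟨h, hab⟩ e' he' u v huv hr
    by_cases hee : e' = e
    · subst hee
      rw [Finset.erase_insert hne] at hr
      rw [he, Sym2.eq_iff] at huv
      rcases huv with ⟨rfl, rfl⟩ | ⟨rfl, rfl⟩
      · exact hab hr
      · exact hab (reach_symm hr)
    · have he'F : e' ∈ F := by
        rcases Finset.mem_insert.1 he' with h | h
        · exact absurd h hee
        · exact h
      rw [Finset.erase_insert_of_ne (Ne.symm hee), reach_insert he] at hr
      have hs := Finset.erase_subset e' F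
      have huv' : Reachable ends F u v := reach_edge he'F huv
      rcases hr with hr | ⟨h1, h2⟩ | ⟨h1, h2⟩
      · exact h e' he'F u v huv hr
      · exact hab (reach_trans (reach_symm (reach_mono hs h1))
          (reach_trans huv' (reach_symm (reach_mono hs h2))))
      · exact hab (reach_trans (reach_mono hs h2)
          (reach_trans (reach_symm huv') (reach_mono hs h1)))

/-- Adding a star of edges centred at `z`: reachability. -/
theorem reach_star [DecidableEq ε] {ι : Type} (D : Finset ι) (t : ι ↪ ε) (r : ι → ν) (z : ν)
    (ht : ∀ i ∈ D, ends (t i) = s(z, r i)) {u v : ν} :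
    Reachable ends (D.map t ∪ F) u v ↔ Reachable ends F u v ∨
      ((Reachable ends F u z ∨ ∃ i ∈ D, Reachable ends F u (r i)) ∧
       (Reachable ends F v z ∨ ∃ i ∈ D, Reachable ends F v (r i))) := by
  have hs : F ⊆ D.map t ∪ F := Finset.subset_union_right
  constructor
  · intro h
    refine reach_induct h (fun v => Reachable ends F u v ∨
      ((Reachable ends F u z ∨ ∃ i ∈ D, Reachable ends F u (r i)) ∧
       (Reachable ends F v z ∨ ∃ i ∈ D, Reachable ends F v (r i)))) ?_ (Or.inl (reach_refl u))
    intro x y f hf hxy hx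
    rw [Finset.mem_union] at hf
    rcases hf with hf | hf
    · rw [Finset.mem_map] at hf
      obtain ⟨i, hi, rfl⟩ := hf
      rw [ht i hi, Sym2.eq_iff] at hxy
      right
      rcases hxy with ⟨rfl, rfl⟩ | ⟨rfl, rfl⟩
      · refine ⟨?_, Or.inr ⟨i, hi, reach_refl _⟩⟩
        rcases hx with hx | ⟨h1, h2⟩
        · exact Or.inl hx
        · exact h1
      · refine ⟨?_, Or.inl (reach_refl _)⟩
        rcases hx with hx | ⟨h1, h2⟩
        · exact Or.inr ⟨i, hi, hx⟩
        · exact h1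
    · have hxy' := reach_edge hf hxy
      rcases hx with hx | ⟨h1, h2⟩
      · exact Or.inl (reach_trans hx hxy')
      · refine Or.inr ⟨h1, ?_⟩
        rcases h2 with h2 | ⟨i, hi, h2⟩
        · exact Or.inl (reach_trans (reach_symm hxy') h2)
        · exact Or.inr ⟨i, hi, reach_trans (reach_symm hxy') h2⟩
  · have key : ∀ u, (Reachable ends F u z ∨ ∃ i ∈ D, Reachable ends F u (r i)) →
        Reachable ends (D.map t ∪ F) u z := by
      rintro u (h | ⟨i, hi, h⟩)
      · exact reach_mono hs h
      · refine reach_trans (reach_mono hs h) (reach_symm (reach_edge (e := t i) ?_ (ht i hi)))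
        exact Finset.mem_union_left _ (Finset.mem_map_of_mem _ hi)
    rintro (h | ⟨h1, h2⟩)
    · exact reach_mono hs h
    · exact reach_trans (key _ h1) (reach_symm (key _ h2))

/-- Adding a star of edges centred at `z`: acyclicity. -/
theorem acyc_star [DecidableEq ε] {ι : Type} (D : Finset ι) (t : ι ↪ ε) (r : ι → ν) (z : ν)
    (ht : ∀ i ∈ D, ends (t i) = s(z, r i)) (hd : ∀ i ∈ D, t i ∉ F) :
    IsAcyclic ends (D.map t ∪ F) ↔ IsAcyclic ends F ∧
      (∀ i ∈ D, ¬ Reachable ends F z (r i)) ∧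
      (∀ i ∈ D, ∀ j ∈ D, i ≠ j → ¬ Reachable ends F (r i) (r j)) := by
  induction D using Finset.induction_on with
  | empty => simp
  | insert i D hi ih =>
    have ih' := ih (fun j hj => ht j (Finset.mem_insert_of_mem hj))
      (fun j hj => hd j (Finset.mem_insert_of_mem hj))
    rw [Finset.map_insert, Finset.insert_union, acyc_insert (a := z) (b := r i) ?_
      (ht i (Finset.mem_insert_self _ _)), ih',
      reach_star D t r z (fun j hj => ht j (Finset.mem_insert_of_mem hj))]
    · constructor
      · rintro ⟨⟨h1, h2, h3⟩, h4⟩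
        push Not at h4
        refine ⟨h1, ?_, ?_⟩
        · intro j hj
          rcases Finset.mem_insert.1 hj with rfl | hj
          · exact h4.1
          · exact h2 j hj
        · have h5 := h4.2 (Or.inl (reach_refl z))
          intro j hj k hk hjk
          rcases Finset.mem_insert.1 hj with rfl | hj' <;>
          rcases Finset.mem_insert.1 hk with rfl | hk'
          · exact absurd rfl hjk
          · exact h5.2 k hk'
          · exact fun h => h5.2 j hj' (reach_symm h)
          · exact h3 j hj' k hk' hjk
      · rintro ⟨h1, h2, h3⟩
        refine ⟨⟨h1, fun j hj => h2 j (Finset.mem_insert_of_mem hj), fun j hj k hk =>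
          h3 j (Finset.mem_insert_of_mem hj) k (Finset.mem_insert_of_mem hk)⟩, ?_⟩
        rintro (h | ⟨-, h | ⟨j, hj, h⟩⟩)
        · exact h2 i (Finset.mem_insert_self _ _) h
        · exact h2 i (Finset.mem_insert_self _ _) (reach_symm h)
        · refine h3 i (Finset.mem_insert_self _ _) j (Finset.mem_insert_of_mem hj) ?_ h
          rintro rfl
          exact hi hj
    · rw [Finset.mem_union, not_or]
      refine ⟨?_, hd i (Finset.mem_insert_self _ _)⟩
      simpa using hi

/-- Transfer of reachability along an embedding of graphs. -/
theorem reach_map {ε' ν' : Type} {ends' : ε' → Sym2 ν'} (f : ε ↪ ε') (φ : ν → ν')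
    (hφ : Function.Injective φ) (hf : ∀ e, ends' (f e) = (ends e).map φ) {u : ν} {y : ν'} :
    Reachable ends' (F.map f) (φ u) y ↔ ∃ v, y = φ v ∧ Reachable ends F u v := by
  constructor
  · intro h
    refine reach_induct h (fun y => ∃ v, y = φ v ∧ Reachable ends F u v) ?_ ⟨u, rfl, reach_refl u⟩
    rintro _ b e he hab ⟨v, rfl, hv⟩
    obtain ⟨e, he', rfl⟩ := Finset.mem_map.1 he
    rw [hf] at hab
    generalize hx : ends e = x at hab
    induction x using Sym2.ind with
    | _ p q =>
      rw [Sym2.map_mk, Sym2.eq_iff] at hab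
      rcases hab with ⟨h1, h2⟩ | ⟨h1, h2⟩
      · have := hφ h1
        subst this
        exact ⟨q, h2.symm, reach_trans hv (reach_edge he' hx)⟩
      · have := hφ h2
        subst this
        exact ⟨p, h1.symm, reach_trans hv (reach_symm (reach_edge he' hx))⟩
  · rintro ⟨v, rfl, h⟩
    refine reach_induct h (fun v => Reachable ends' (F.map f) (φ u) (φ v)) ?_ (reach_refl _)
    intro a b e he hab h
    exact reach_trans h (reach_edge (e := f e) (Finset.mem_map_of_mem _ he) (by rw [hf, hab]; rfl))

theorem reach_map' {ε' ν' : Type} {ends' : ε' → Sym2 ν'} (f : ε ↪ ε') (φ : ν → ν')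
    (hφ : Function.Injective φ) (hf : ∀ e, ends' (f e) = (ends e).map φ) {u v : ν} :
    Reachable ends' (F.map f) (φ u) (φ v) ↔ Reachable ends F u v := by
  rw [reach_map f φ hφ hf]
  constructor
  · rintro ⟨w, hw, h⟩
    rwa [hφ hw]
  · exact fun h => ⟨v, rfl, h⟩

theorem acyc_map [DecidableEq ε] {ε' ν' : Type} [DecidableEq ε'] {ends' : ε' → Sym2 ν'}
    (f : ε ↪ ε') (φ : ν → ν')
    (hφ : Function.Injective φ) (hf : ∀ e, ends' (f e) = (ends e).map φ) :
    IsAcyclic ends' (F.map f) ↔ IsAcyclic ends F := by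
  constructor
  · intro h e he u v huv hr
    refine h (f e) (Finset.mem_map_of_mem _ he) (φ u) (φ v) (by rw [hf, huv]; rfl) ?_
    rwa [← Finset.map_erase, reach_map' f φ hφ hf]
  · intro h e he u v huv hr
    obtain ⟨e, he', rfl⟩ := Finset.mem_map.1 he
    rw [hf] at huv
    rw [← Finset.map_erase] at hr
    generalize hx : ends e = x at huv
    induction x using Sym2.ind with
    | _ p q =>
      rw [Sym2.map_mk, Sym2.eq_iff] at huv
      rcases huv with ⟨rfl, rfl⟩ | ⟨rfl, rfl⟩
      · exact h e he' p q hx ((reach_map' f φ hφ hf).1 hr)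
      · exact h e he' p q hx (reach_symm ((reach_map' f φ hφ hf).1 hr))

/-! #### Paths -/

theorem mem_support_start {u v : ν} (p : MWalk ends u v) : u ∈ p.support := by
  cases p <;> simp [MWalk.support]

theorem mem_support_of_mem_edges {u v : ν} (p : MWalk ends u v) {e : ε} (he : e ∈ p.edges)
    {a : ν} (ha : a ∈ ends e) : a ∈ p.support := by
  induction p with
  | nil u => simp [MWalk.edges] at he
  | cons f w h q ih =>
    simp only [MWalk.edges, List.mem_cons] at he
    simp only [MWalk.support, List.mem_cons]
    rcases he with rfl | he
    · rw [h, Sym2.mem_iff] at ha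
      rcases ha with rfl | rfl
      · exact Or.inl rfl
      · exact Or.inr (mem_support_start q)
    · exact Or.inr (ih he)

theorem exists_suffix {u v w : ν} (p : MWalk ends v w) (hp : p.IsPath) (hF : p.edgesIn F)
    (hu : u ∈ p.support) : ∃ q : MWalk ends u w, q.IsPath ∧ q.edgesIn F := by
  induction p with
  | nil x =>
    simp only [MWalk.support, List.mem_singleton] at hu
    subst hu
    exact ⟨_, hp, hF⟩
  | cons e x h q ih =>
    simp only [MWalk.support, List.mem_cons] at hu
    rcases hu with rfl | hu
    · exact ⟨_, hp, hF⟩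
    · simp only [MWalk.IsPath, MWalk.support, List.nodup_cons] at hp
      exact ih hp.2 (fun e' he' => hF e' (by simp [MWalk.edges, he'])) hu

theorem exists_path {u v : ν} (h : Reachable ends F u v) :
    ∃ p : MWalk ends u v, p.IsPath ∧ p.edgesIn F := by
  obtain ⟨p, hp⟩ := h
  induction p with
  | nil u => exact ⟨MWalk.nil u, by simp [MWalk.IsPath, MWalk.support], hp⟩
  | @cons u' w' e x h q ih =>
    obtain ⟨q', h1, h2⟩ := ih (fun e' he' => hp e' (by simp [MWalk.edges, he']))
    have he : e ∈ F := hp e (by simp [MWalk.edges])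
    by_cases hu : u' ∈ q'.support
    · exact exists_suffix q' h1 h2 hu
    · refine ⟨MWalk.cons e x h q', ?_, ?_⟩
      · simp only [MWalk.IsPath, MWalk.support, List.nodup_cons]
        exact ⟨hu, h1⟩
      · intro e' he'
        simp only [MWalk.edges, List.mem_cons] at he'
        rcases he' with rfl | he'
        · exact he
        · exact h2 _ he'

theorem path_cons_not_mem {u v w : ν} {e : ε} {h : ends e = s(u, v)} {q : MWalk ends v w}
    (hp : (MWalk.cons e v h q).IsPath) : e ∉ q.edges := by
  simp only [MWalk.IsPath, MWalk.support, List.nodup_cons] at hp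
  exact fun he => hp.1 (mem_support_of_mem_edges q he (by rw [h]; simp))

/-- `e` is the first edge on the way from `u` to `v` inside `F`. -/
def FirstEdge [DecidableEq ε] (ends : ε → Sym2 ν) (F : Finset ε) (u : ν) (e : ε) (v : ν) : Prop :=
  e ∈ F ∧ ∃ w, ends e = s(u, w) ∧ Reachable ends (F.erase e) w v

theorem firstEdge_of_head [DecidableEq ε] {u v : ν} (p : MWalk ends u v) (hp : p.IsPath)
    (hF : p.edgesIn F) {e : ε} (he : p.edges.head? = some e) : FirstEdge ends F u e v := by
  cases p with
  | nil => simp [MWalk.edges] at he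
  | cons f w h q =>
    simp only [MWalk.edges, List.head?_cons, Option.some.injEq] at he
    subst he
    refine ⟨hF _ (by simp [MWalk.edges]), w, h, q, ?_⟩
    intro e' he'
    rw [Finset.mem_erase]
    refine ⟨?_, hF _ (by simp [MWalk.edges, he'])⟩
    rintro rfl
    exact path_cons_not_mem hp he'

theorem firstEdge_of_last [DecidableEq ε] {u v : ν} (p : MWalk ends u v) (hp : p.IsPath)
    (hF : p.edgesIn F) {e : ε} (he : p.edges.getLast? = some e) : FirstEdge ends F v e u := by
  induction p with
  | nil => simp [MWalk.edges] at he
  | cons f w h q ih =>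
    have hfF : f ∈ F := hF _ (by simp [MWalk.edges])
    have hnot := path_cons_not_mem hp
    cases q with
    | nil =>
      simp only [MWalk.edges, List.getLast?_singleton, Option.some.injEq] at he
      subst he
      exact ⟨hfF, _, by rw [h, Sym2.eq_swap], reach_refl _⟩
    | cons f' w' h' q' =>
      have hl : (MWalk.cons f' w' h' q').edges.getLast? = some e := by
        simpa [MWalk.edges] using he
      have hq : (MWalk.cons f' w' h' q').IsPath := by
        simp only [MWalk.IsPath, MWalk.support, List.nodup_cons] at hp ⊢
        exact hp.2
      obtain ⟨heF, x, hx, hr⟩ := ih hq (fun e' he' => hF e' (by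
        simp only [MWalk.edges] at he' ⊢; exact List.mem_cons_of_mem _ he')) hl
      refine ⟨heF, x, hx, reach_trans hr (reach_symm (reach_edge (e := f) ?_ h))⟩
      rw [Finset.mem_erase]
      refine ⟨?_, hfF⟩
      rintro rfl
      exact hnot (List.mem_of_getLast? hl)

theorem path_single {u v : ν} (p : MWalk ends u v) (hp : p.IsPath) {e : ε}
    (h1 : p.edges.head? = some e) (h2 : p.edges.getLast? = some e) : p.edges = [e] := by
  cases p with
  | nil => simp [MWalk.edges] at h1
  | cons f w h q =>
    have hnot := path_cons_not_mem hp
    simp only [MWalk.edges, List.head?_cons, Option.some.injEq] at h1 h2 ⊢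
    subst h1
    cases hq : q.edges with
    | nil => rfl
    | cons a l =>
      rw [hq, List.getLast?_cons_cons, ← hq] at h2
      exact absurd (List.mem_of_getLast? h2) hnot

theorem odd_bridge (sd : ν → Bool) {u v : ν} (p : MWalk ends u v) :
    Odd (p.bridgeCount sd) ↔ sd u ≠ sd v := by
  induction p with
  | nil => simp [MWalk.bridgeCount]
  | @cons u' w' e w h q ih =>
    simp only [MWalk.bridgeCount]
    split_ifs with hs
    · rw [zero_add, ih, hs]
    · rw [Nat.odd_add, ← Nat.not_odd_iff_even, ih]
      revert hs
      cases sd u' <;> cases sd w <;> cases sd w' <;> simp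

theorem path_edges_ne {u v : ν} (h : u ≠ v) (p : MWalk ends u v) :
    ∃ e f, p.edges.head? = some e ∧ p.edges.getLast? = some f := by
  cases p with
  | nil => exact absurd rfl h
  | cons f w h q =>
    exact ⟨f, _, rfl, List.getLast?_eq_some_getLast (List.cons_ne_nil f q.edges)⟩

section Acyclic
variable [DecidableEq ε]

theorem firstEdge_exists {u v : ν} (hne : u ≠ v) (h : Reachable ends F u v) :
    ∃ e, FirstEdge ends F u e v := by
  obtain ⟨p, hp, hF⟩ := exists_path h
  obtain ⟨e, f, he, hf⟩ := path_edges_ne hne p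
  exact ⟨e, firstEdge_of_head p hp hF he⟩

theorem FirstEdge.reach {u v : ν} {e : ε} (h : FirstEdge ends F u e v) :
    Reachable ends F u v := by
  obtain ⟨he, w, hw, hr⟩ := h
  exact reach_step he hw (reach_mono (Finset.erase_subset _ _) hr)

/-- An edge of an acyclic set does not have two "first" directions to the same target. -/
theorem firstEdge_inj (hF : IsAcyclic ends F) {u u' v : ν} {e : ε}
    (h : FirstEdge ends F u e v) (h' : FirstEdge ends F u' e v) : u = u' := by
  obtain ⟨he, w, hw, hr⟩ := h
  obtain ⟨-, w', hw', hr'⟩ := h'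
  by_contra hne
  have : u = w' ∧ w = u' := by
    rw [hw, Sym2.eq_iff] at hw'
    rcases hw' with h | h
    · exact absurd h.1 hne
    · exact h
  obtain ⟨rfl, rfl⟩ := this
  exact hF e he _ _ hw (reach_trans hr' (reach_symm hr))

theorem firstEdge_surj {v u : ν} {e : ε} (he : e ∈ F) (hu : u ∈ ends e)
    (hr : Reachable ends F u v) : ∃ x, FirstEdge ends F x e v := by
  obtain ⟨w, hw⟩ := hu
  have h1 := hr
  rw [← Finset.insert_erase he, reach_insert hw] at h1
  rcases h1 with h | ⟨-, h⟩ | ⟨-, h⟩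
  · exact ⟨w, he, u, by rw [hw, Sym2.eq_swap], h⟩
  · exact ⟨u, he, w, hw, h⟩
  · exact ⟨w, he, u, by rw [hw, Sym2.eq_swap], h⟩

theorem firstEdge_ne (hF : IsAcyclic ends F) {u v : ν} {e : ε}
    (h : FirstEdge ends F u e v) : u ≠ v := by
  rintro rfl
  obtain ⟨he, w, hw, hr⟩ := h
  exact hF e he _ _ hw (reach_symm hr)

theorem firstEdge_unique (hF : IsAcyclic ends F) {u v : ν} {e e' : ε}
    (h : FirstEdge ends F u e v) (h' : FirstEdge ends F u e' v) : e = e' := by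
  obtain ⟨he, w, hw, hr⟩ := h
  obtain ⟨he', w', hw', hr'⟩ := h'
  by_contra hne
  have hee : e ∈ F.erase e' := Finset.mem_erase.2 ⟨hne, he⟩
  have hee' : e' ∈ F.erase e := Finset.mem_erase.2 ⟨Ne.symm hne, he'⟩
  have hs1 : (F.erase e').erase e ⊆ F.erase e := by
    rw [Finset.erase_right_comm]; exact Finset.erase_subset _ _
  have hs2 : (F.erase e').erase e ⊆ F.erase e' := Finset.erase_subset _ _
  have hwu : Reachable ends (F.erase e) w' u := reach_symm (reach_edge hee' hw')
  rw [← Finset.insert_erase hee, reach_insert hw] at hr'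
  rcases hr' with h | ⟨h1, h2⟩ | ⟨h1, h2⟩
  · exact hF e he _ _ hw (reach_symm (reach_trans hr
      (reach_trans (reach_symm (reach_mono hs1 h)) hwu)))
  · exact hF e' he' _ _ hw' (reach_symm (reach_mono hs2 h1))
  · exact hF e he _ _ hw (reach_symm (reach_trans (reach_symm (reach_mono hs1 h1)) hwu))

/-- Injectivity of "(first edge, last edge)". -/
theorem firstEdge_pair_inj (hF : IsAcyclic ends F) {u v u' v' : ν} {e f : ε} (hef : e ≠ f)
    (h1 : FirstEdge ends F u e v) (h2 : FirstEdge ends F v f u)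
    (h1' : FirstEdge ends F u' e v') (h2' : FirstEdge ends F v' f u') : u = u' := by
  have hv : v ∈ ends f := by obtain ⟨-, w, hw, -⟩ := h2; rw [hw]; simp
  have hv' : v' ∈ ends f := by obtain ⟨-, w, hw, -⟩ := h2'; rw [hw]; simp
  have hvv : Reachable ends (F.erase e) v' v :=
    reach_of_mem (Finset.mem_erase.2 ⟨hef.symm, h2.1⟩) hv' hv
  obtain ⟨he, w', hw', hr'⟩ := h1'
  exact firstEdge_inj hF h1 ⟨he, w', hw', reach_trans hr' hvv⟩

theorem firstEdge_both_ends (hF : IsAcyclic ends F) {u v : ν} {e : ε}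
    (h1 : FirstEdge ends F u e v) (h2 : FirstEdge ends F v e u) : ends e = s(u, v) := by
  obtain ⟨he, w, hw, hr⟩ := h1
  have hne := firstEdge_ne hF h2
  obtain ⟨-, w2, hw2, hr2⟩ := h2
  have h3 := hw2
  rw [hw, Sym2.eq_iff] at h3
  rcases h3 with ⟨h, -⟩ | ⟨-, h⟩
  · exact absurd h.symm hne
  · rw [hw, h]

end Acyclic

end Graph

/-! ### Part 2: weighted enumeration of configurations, component by component -/

section Weights

variable {X Q : Type} [Fintype X] [Fintype Q]

/-- Restriction of `g` to the fibre of `c`. -/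
def restr (comp : X → Q) (c : Q) (g : X → ℕ) : X → ℕ := fun x => if comp x = c then g x else 0

/-- Number of roots in `c` (the component `q0` has one extra root). -/
def cnt (comp : X → Q) (q0 : Q) (c : Q) (g : X → ℕ) : ℕ :=
  (∑ x, restr comp c g x) + if c = q0 then 1 else 0

/-- At most one component has two roots, none has more, and the double component is good. -/
def Valid (comp : X → Q) (q0 : Q) (good : Q → (X → ℕ) → Prop) (g : X → ℕ) : Prop :=
  (∀ c, cnt comp q0 c g ≤ 2) ∧
  (∀ c c', cnt comp q0 c g = 2 → cnt comp q0 c' g = 2 → c = c') ∧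
  (∀ c, cnt comp q0 c g = 2 → good c (restr comp c g))

/-- Configurations supported on the fibre of `c`. -/
def locSet (comp : X → Q) (s : X → Finset ℕ) (c : Q) : Finset (X → ℕ) :=
  Fintype.piFinset fun x => if comp x = c then s x else {0}

theorem sum_prod_local {R : Type} [CommSemiring R] (comp : X → Q) (s : X → Finset ℕ)
    (w : Q → (X → ℕ) → R) :
    ∑ g ∈ Fintype.piFinset s, ∏ c, w c (restr comp c g)
      = ∏ c, ∑ k ∈ locSet comp s c, w c k := by
  rw [Finset.prod_univ_sum]
  refine Finset.sum_bij' (fun g _ c => restr comp c g) (fun φ _ x => φ (comp x) x) ?_ ?_ ?_ ?_ ?_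
  · intro g hg
    simp only [Fintype.mem_piFinset, locSet, restr] at hg ⊢
    intro c x
    split_ifs
    · exact hg x
    · simp
  · intro φ hφ
    simp only [Fintype.mem_piFinset, locSet] at hφ ⊢
    intro x
    simpa using hφ (comp x) x
  · intro g hg
    funext x
    simp [restr]
  · intro φ hφ
    simp only [Fintype.mem_piFinset, locSet] at hφ
    funext c x
    simp only [restr]
    split_ifs with h
    · rw [h]
    · have := hφ c x
      rw [if_neg h] at this
      exact (Finset.mem_singleton.1 this).symm
  · intro g hg
    rfl

theorem sum_cnt (comp : X → Q) (q0 : Q) (g : X → ℕ) :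
    ∑ c, cnt comp q0 c g = ∑ x, g x + 1 := by
  simp only [cnt, Finset.sum_add_distrib, restr]
  rw [Finset.sum_comm]
  simp

variable {R : Type} [CommRing R]

/-- Weight of a local configuration. -/
def wt (q0 : Q) (good : Q → (X → ℕ) → Prop) (y : R) (c : Q) (k : X → ℕ) : DualNumber R :=
  if (∑ x, k x) + (if c = q0 then 1 else 0) = 0 then TrivSqZeroExt.inl y else
  if (∑ x, k x) + (if c = q0 then 1 else 0) = 1 then 1 else
  if (∑ x, k x) + (if c = q0 then 1 else 0) = 2 ∧ good c k then DualNumber.eps else 0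

theorem valid_sum_le {comp : X → Q} {q0 : Q} {good : Q → (X → ℕ) → Prop} {g : X → ℕ}
    (h : Valid comp q0 good g) : ∑ x, g x ≤ Fintype.card Q := by
  have h1 := sum_cnt comp q0 g
  have h2 : ∀ c, cnt comp q0 c g ≤ 1 + if cnt comp q0 c g = 2 then 1 else 0 := by
    intro c
    have := h.1 c
    split_ifs <;> omega
  have h3 := Finset.sum_le_sum (s := Finset.univ) (fun c _ => h2 c)
  rw [h1, Finset.sum_add_distrib] at h3
  simp only [Finset.sum_const, Finset.card_univ, smul_eq_mul, mul_one, Finset.sum_boole,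
    Nat.cast_id] at h3
  have h4 : (Finset.univ.filter fun c => cnt comp q0 c g = 2).card ≤ 1 := by
    rw [Finset.card_le_one]
    intro a ha b hb
    exact h.2.1 a b (Finset.mem_filter.1 ha).2 (Finset.mem_filter.1 hb).2
  omega

theorem eval_prod (comp : X → Q) (q0 : Q) (good : Q → (X → ℕ) → Prop) (y : R) (g : X → ℕ) :
    y * (∏ c, wt q0 good y c (restr comp c g)).fst + (∏ c, wt q0 good y c (restr comp c g)).snd
      = if Valid comp q0 good g then y ^ (Fintype.card Q - ∑ x, g x) else 0 := by
  by_cases h : ∀ c, cnt comp q0 c g ≤ 2 ∧ (cnt comp q0 c g = 2 → good c (restr comp c g))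
  · have hw : ∀ c, wt q0 good y c (restr comp c g) =
        (TrivSqZeroExt.inl y : DualNumber R) ^ (if cnt comp q0 c g = 0 then 1 else 0) *
        (DualNumber.eps : DualNumber R) ^ (if cnt comp q0 c g = 2 then 1 else 0) := by
      intro c
      obtain ⟨h1, h2⟩ := h c
      unfold wt
      unfold cnt at h1 h2 ⊢
      generalize (∑ x, restr comp c g x) + (if c = q0 then 1 else 0) = n at h1 h2 ⊢
      interval_cases n
      · simp
      · simp
      · simp [h2 rfl]
    rw [Finset.prod_congr rfl (fun c _ => hw c), Finset.prod_mul_distrib,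
      Finset.prod_pow_eq_pow_sum, Finset.prod_pow_eq_pow_sum]
    simp only [Finset.sum_boole, Nat.cast_id]
    have hc : ∑ c, (cnt comp q0 c g + if cnt comp q0 c g = 0 then 1 else 0)
        = ∑ c, (1 + if cnt comp q0 c g = 2 then 1 else 0) := by
      refine Finset.sum_congr rfl fun c _ => ?_
      obtain ⟨h1, -⟩ := h c
      generalize cnt comp q0 c g = n at h1 ⊢
      interval_cases n <;> simp
    rw [Finset.sum_add_distrib, Finset.sum_add_distrib, sum_cnt] at hc
    simp only [Finset.sum_const, Finset.card_univ, smul_eq_mul, mul_one, Finset.sum_boole,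
      Nat.cast_id] at hc
    have hv : Valid comp q0 good g ↔
        (Finset.univ.filter fun c => cnt comp q0 c g = 2).card ≤ 1 := by
      rw [Finset.card_le_one]
      simp only [Finset.mem_filter, Finset.mem_univ, true_and]
      constructor
      · exact fun hv a ha b hb => hv.2.1 a b ha hb
      · exact fun hv => ⟨fun c => (h c).1, fun a b ha hb => hv a ha b hb, fun c => (h c).2⟩
    generalize (Finset.univ.filter fun c => cnt comp q0 c g = 2).card = D at *
    generalize (Finset.univ.filter fun c => cnt comp q0 c g = 0).card = Z at *
    rw [TrivSqZeroExt.inl_pow]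
    by_cases hD : D ≤ 1
    · rw [if_pos (hv.2 hD)]
      interval_cases D
      · have : Fintype.card Q - ∑ x, g x = Z + 1 := by omega
        rw [this]
        simp [pow_succ, mul_comm]
      · have : Fintype.card Q - ∑ x, g x = Z := by omega
        rw [this]
        simp
    · rw [if_neg (fun h' => hD (hv.1 h'))]
      obtain ⟨j, rfl⟩ : ∃ j, D = j + 2 := ⟨D - 2, by omega⟩
      have : (DualNumber.eps : DualNumber R) ^ (j + 2) = 0 := by
        rw [pow_add, pow_two, DualNumber.eps_mul_eps, mul_zero]
      rw [this]
      simp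
  · have hv : ¬ Valid comp q0 good g := fun hv => h fun c => ⟨hv.1 c, hv.2.2 c⟩
    rw [if_neg hv]
    push Not at h
    obtain ⟨c, hc⟩ := h
    have h0 : wt q0 good y c (restr comp c g) = 0 := by
      unfold wt
      unfold cnt at hc
      generalize (∑ x, restr comp c g x) + (if c = q0 then 1 else 0) = n at hc ⊢
      by_cases hn : n ≤ 2
      · obtain ⟨h1, h2⟩ := hc hn
        subst h1
        simp [h2]
      · rw [if_neg (by omega), if_neg (by omega), if_neg (by omega)]
    rw [Finset.prod_eq_zero (Finset.mem_univ c) h0]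
    simp

/-- Number of local configurations with one root. -/
def num1 (comp : X → Q) (s : X → Finset ℕ) (c : Q) : ℕ :=
  ((locSet comp s c).filter fun k => ∑ x, k x = 1).card
/-- Number of good local configurations with one root. -/
def numG1 (comp : X → Q) (s : X → Finset ℕ) (good : Q → (X → ℕ) → Prop) (c : Q) : ℕ :=
  ((locSet comp s c).filter fun k => ∑ x, k x = 1 ∧ good c k).card
/-- Number of good local configurations with two roots. -/
def numG2 (comp : X → Q) (s : X → Finset ℕ) (good : Q → (X → ℕ) → Prop) (c : Q) : ℕ :=
  ((locSet comp s c).filter fun k => ∑ x, k x = 2 ∧ good c k).card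

theorem locSet_zero (comp : X → Q) (s : X → Finset ℕ) (hs : ∀ x, 0 ∈ s x) (c : Q) :
    ((locSet comp s c).filter fun k => ∑ x, k x = 0) = {0} := by
  ext k
  simp only [Finset.mem_filter, Finset.mem_singleton, Finset.sum_eq_zero_iff, Finset.mem_univ,
    true_implies]
  constructor
  · rintro ⟨-, h⟩
    funext x
    exact h x
  · rintro rfl
    refine ⟨?_, fun _ => rfl⟩
    simp only [locSet, Fintype.mem_piFinset]
    intro x
    split_ifs <;> simp [hs]

theorem sum_wt_ne (comp : X → Q) (s : X → Finset ℕ) (hs : ∀ x, 0 ∈ s x) (q0 : Q)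
    (good : Q → (X → ℕ) → Prop) (y : R) (c : Q) (hc : c ≠ q0) :
    ∑ k ∈ locSet comp s c, wt q0 good y c k =
      (TrivSqZeroExt.inl y : DualNumber R) + (num1 comp s c : DualNumber R) +
        (numG2 comp s good c : DualNumber R) * DualNumber.eps := by
  have h : ∀ k : X → ℕ, wt q0 good y c k =
      (if ∑ x, k x = 0 then (TrivSqZeroExt.inl y : DualNumber R) else 0) +
      (if ∑ x, k x = 1 then 1 else 0) +
      (if ∑ x, k x = 2 ∧ good c k then DualNumber.eps else 0) := by
    intro k
    unfold wt
    rw [if_neg hc, add_zero]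
    generalize ∑ x, k x = n
    by_cases h0 : n = 0
    · subst h0; simp
    by_cases h1 : n = 1
    · subst h1; simp
    simp [h0, h1]
  rw [Finset.sum_congr rfl (fun k _ => h k), Finset.sum_add_distrib, Finset.sum_add_distrib,
    ← Finset.sum_filter, ← Finset.sum_filter, ← Finset.sum_filter, locSet_zero comp s hs]
  simp [num1, numG2]

theorem sum_wt_eq (comp : X → Q) (s : X → Finset ℕ) (hs : ∀ x, 0 ∈ s x) (q0 : Q)
    (good : Q → (X → ℕ) → Prop) (y : R) :
    ∑ k ∈ locSet comp s q0, wt q0 good y q0 k =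
      1 + (numG1 comp s good q0 : DualNumber R) * DualNumber.eps := by
  have h : ∀ k : X → ℕ, wt q0 good y q0 k =
      (if ∑ x, k x = 0 then (1 : DualNumber R) else 0) +
      (if ∑ x, k x = 1 ∧ good q0 k then DualNumber.eps else 0) := by
    intro k
    unfold wt
    rw [if_pos rfl]
    generalize ∑ x, k x = n
    by_cases h0 : n = 0
    · subst h0; simp
    by_cases h1 : n = 1
    · subst h1; simp
    simp [h0, h1]
  rw [Finset.sum_congr rfl (fun k _ => h k), Finset.sum_add_distrib,
    ← Finset.sum_filter, ← Finset.sum_filter, locSet_zero comp s hs]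
  simp [numG1]

theorem general_sum (comp : X → Q) (s : X → Finset ℕ) (hs : ∀ x, 0 ∈ s x) (q0 : Q)
    (good : Q → (X → ℕ) → Prop) (y : R) (P : DualNumber R)
    (hP : P = ∏ c ∈ Finset.univ.erase q0,
      ((TrivSqZeroExt.inl y : DualNumber R) + (num1 comp s c : DualNumber R) +
        (numG2 comp s good c : DualNumber R) * DualNumber.eps)) :
    ∑ g ∈ (Fintype.piFinset s).filter (Valid comp q0 good), y ^ (Fintype.card Q - ∑ x, g x)
      = y * P.fst + P.snd + (numG1 comp s good q0 : R) * P.fst := by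
  have h1 := sum_prod_local comp s (wt q0 good y)
  rw [← Finset.mul_prod_erase _ _ (Finset.mem_univ q0), sum_wt_eq comp s hs,
    Finset.prod_congr rfl (fun c hc => sum_wt_ne comp s hs q0 good y c (Finset.ne_of_mem_erase hc)),
    ← hP] at h1
  rw [Finset.sum_filter, Finset.sum_congr rfl (fun g _ => (eval_prod comp q0 good y g).symm),
    Finset.sum_add_distrib, ← Finset.mul_sum, ← TrivSqZeroExt.fst_sum, ← TrivSqZeroExt.snd_sum, h1]
  simp
  ring

theorem compare_sum {X' : Type} [Fintype X'] (comp : X → Q) (s : X → Finset ℕ)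
    (hs : ∀ x, 0 ∈ s x) (comp' : X' → Q) (s' : X' → Finset ℕ)
    (hs' : ∀ x, 0 ∈ s' x) (q0 : Q)
    (good : Q → (X → ℕ) → Prop) (good' : Q → (X' → ℕ) → Prop) (t : R)
    (h1 : ∀ c, c ≠ q0 → num1 comp s c = num1 comp' s' c + 1)
    (h2 : ∀ c, c ≠ q0 → numG2 comp s good c = numG2 comp' s' good' c)
    (h3 : numG1 comp s good q0 = numG1 comp' s' good' q0 + 1) :
    ∑ g ∈ (Fintype.piFinset s).filter (Valid comp q0 good),
        (t - 1) ^ (Fintype.card Q - ∑ x, g x)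
      = ∑ g ∈ (Fintype.piFinset s').filter (Valid comp' q0 good'),
          t ^ (Fintype.card Q - ∑ x, g x) := by
  rw [general_sum comp' s' hs' q0 good' t _ rfl, general_sum comp s hs q0 good (t - 1)
    (∏ c ∈ Finset.univ.erase q0,
      ((TrivSqZeroExt.inl t : DualNumber R) + (num1 comp' s' c : DualNumber R) +
        (numG2 comp' s' good' c : DualNumber R) * DualNumber.eps)), h3]
  · push_cast
    ring
  · refine Finset.prod_congr rfl fun c hc => ?_
    have hc' := Finset.ne_of_mem_erase hc
    rw [h1 c hc', h2 c hc', TrivSqZeroExt.inl_sub]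
    push_cast
    rw [TrivSqZeroExt.inl_one]
    ring

end Weights

/-! ### Part 3: the local counts agree -/

section LocalCounts

set_option linter.unusedSectionVars false

theorem eq_single_of_sum_one {X : Type} [Fintype X] {k : X → ℕ} (h : ∑ x, k x = 1) :
    ∃ x, k = Pi.single x 1 := by
  obtain ⟨x, hx⟩ : ∃ x, k x ≠ 0 := by
    by_contra hcon
    push Not at hcon
    simp [hcon] at h
  refine ⟨x, ?_⟩
  have h1 := Finset.add_sum_erase Finset.univ k (Finset.mem_univ x)
  have h2 : ∑ y ∈ Finset.univ.erase x, k y = 0 := by omega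
  have h3 : k x = 1 := by omega
  rw [Finset.sum_eq_zero_iff] at h2
  funext y
  by_cases hy : y = x
  · subst hy; simp [h3]
  · rw [Pi.single_eq_of_ne hy]
    exact h2 y (by simp [hy])

theorem single_one_inj {X : Type} {x y : X}
    (h : (Pi.single x 1 : X → ℕ) = Pi.single y 1) : x = y := by
  by_contra hne
  have := congrFun h x
  rw [Pi.single_eq_same, Pi.single_eq_of_ne hne] at this
  omega

/-- Equality of two-element multisets, as functions. -/
theorem single_add_inj {X : Type} {x y x' y' : X}
    (h : (Pi.single x 1 + Pi.single y 1 : X → ℕ) = Pi.single x' 1 + Pi.single y' 1) :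
    (x = x' ∧ y = y') ∨ (x = y' ∧ y = x') := by
  have h1 : x = x' ∨ x = y' := by
    by_contra hcon
    push Not at hcon
    have := congrFun h x
    simp only [Pi.add_apply, Pi.single_eq_same, Pi.single_eq_of_ne hcon.1,
      Pi.single_eq_of_ne hcon.2] at this
    omega
  rcases h1 with rfl | rfl
  · exact Or.inl ⟨rfl, single_one_inj (add_left_cancel h)⟩
  · rw [add_comm (Pi.single x' 1 : X → ℕ)] at h
    exact Or.inr ⟨rfl, single_one_inj (add_left_cancel h)⟩

theorem eq_single_add_of_sum_two {X : Type} [Fintype X] {k : X → ℕ} (h : ∑ x, k x = 2) {e f : X}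
    (he : 1 ≤ k e) (hf : 1 ≤ k f) (hef : e = f → k e = 2) :
    k = Pi.single e 1 + Pi.single f 1 := by
  have hle : ∀ x, (Pi.single e 1 + Pi.single f 1 : X → ℕ) x ≤ k x := by
    intro x
    simp only [Pi.add_apply, Pi.single_apply]
    by_cases h1 : x = e <;> by_cases h2 : x = f
    · subst h1; subst h2; simp [hef rfl]
    · subst h1; simp [h2, he]
    · subst h2; simp [h1, hf]
    · simp [h1, h2]
  have hs : ∑ x, (Pi.single e 1 + Pi.single f 1 : X → ℕ) x = ∑ x, k x := by
    rw [h]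
    simp [Finset.sum_add_distrib]
  have := (Finset.sum_eq_sum_iff_of_le (fun x _ => hle x)).1 hs
  funext x
  exact (this x (Finset.mem_univ x)).symm

variable {X Q : Type} [Fintype X]

theorem single_mem_locSet {comp : X → Q} {s : X → Finset ℕ} (hs : ∀ x, 0 ∈ s x) {c : Q} {x : X} :
    (Pi.single x 1 : X → ℕ) ∈ locSet comp s c ↔ comp x = c ∧ 1 ∈ s x := by
  simp only [locSet, Fintype.mem_piFinset]
  constructor
  · intro h
    have := h x
    rw [Pi.single_eq_same] at this
    split_ifs at this with hc
    · exact ⟨hc, this⟩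
    · simp at this
  · rintro ⟨h1, h2⟩ y
    by_cases hy : y = x
    · subst hy
      simpa [h1] using h2
    · rw [Pi.single_eq_of_ne hy]
      split_ifs <;> simp [hs]

theorem num1_eq (comp : X → Q) (s : X → Finset ℕ) (hs : ∀ x, 0 ∈ s x) (c : Q) :
    num1 comp s c = (Finset.univ.filter fun x => comp x = c ∧ 1 ∈ s x).card := by
  symm
  refine Finset.card_bij (fun x _ => Pi.single x 1) ?_ ?_ ?_
  · intro x hx
    rw [Finset.mem_filter] at hx ⊢
    exact ⟨(single_mem_locSet hs).2 hx.2, by simp⟩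
  · intro x _ y _ h
    exact single_one_inj h
  · intro k hk
    rw [Finset.mem_filter] at hk
    obtain ⟨x, rfl⟩ := eq_single_of_sum_one hk.2
    exact ⟨x, by simpa using (single_mem_locSet hs).1 hk.1, rfl⟩

theorem numG1_eq (comp : X → Q) (s : X → Finset ℕ) (hs : ∀ x, 0 ∈ s x)
    (good : Q → (X → ℕ) → Prop) (c : Q) :
    numG1 comp s good c =
      (Finset.univ.filter fun x => comp x = c ∧ 1 ∈ s x ∧ good c (Pi.single x 1)).card := by
  symm
  refine Finset.card_bij (fun x _ => Pi.single x 1) ?_ ?_ ?_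
  · intro x hx
    rw [Finset.mem_filter] at hx ⊢
    exact ⟨(single_mem_locSet hs).2 ⟨hx.2.1, hx.2.2.1⟩, by simp, hx.2.2.2⟩
  · intro x _ y _ h
    exact single_one_inj h
  · intro k hk
    rw [Finset.mem_filter] at hk
    obtain ⟨x, rfl⟩ := eq_single_of_sum_one hk.2.1
    have := (single_mem_locSet hs).1 hk.1
    exact ⟨x, by simpa using ⟨this.1, this.2, hk.2.2⟩, rfl⟩

variable {ε ν : Type} [Fintype ε] [Fintype ν]

/-- The component of an edge. -/
def compE (ends : ε → Sym2 ν) (cls : ν → Q) (e : ε) : Q := cls (Quot.out (ends e)).1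

/-- Allowed vertex-root multiplicities. -/
def sL (ν : Type) : ν → Finset ℕ := fun _ => Finset.range 2
/-- Allowed edge-root multiplicities. -/
def sR (F : Finset ε) : ε → Finset ℕ := fun e => if e ∈ F then Finset.range 3 else {0}

/-- Good vertex configurations: exactly one root connected to the apex `0`. -/
def goodL (sd : ν → Bool) (z : ν) (_ : Q) (k : ν → ℕ) : Prop :=
  ∑ v, (if sd v = true ∨ v = z then k v else 0) = 1

/-- Good edge configurations. -/
def goodR (ends : ε → Sym2 ν) (F : Finset ε) (cls : ν → Q) (sd : ν → Bool) (z : ν)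
    (c : Q) (k : ε → ℕ) : Prop :=
  (c = cls z → ∃ x e, sd x = true ∧ FirstEdge ends F x e z ∧ k = Pi.single e 1) ∧
  (c ≠ cls z → ∃ u v e f, sd u = true ∧ sd v = false ∧ cls u = c ∧ FirstEdge ends F u e v ∧
    FirstEdge ends F v f u ∧ k = Pi.single e 1 + Pi.single f 1)

theorem zero_mem_sL (x : ν) : 0 ∈ sL ν x := by simp [sL]
theorem zero_mem_sR (F : Finset ε) (x : ε) : 0 ∈ sR F x := by
  unfold sR; split_ifs <;> simp
theorem one_mem_sR (F : Finset ε) (x : ε) : 1 ∈ sR F x ↔ x ∈ F := by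
  unfold sR; split_ifs with h <;> simp [h]

variable {ends : ε → Sym2 ν} {F : Finset ε} {cls : ν → Q} 

theorem compE_eq (hcls : ∀ u v, cls u = cls v ↔ Reachable ends F u v) {e : ε} (he : e ∈ F)
    {a : ν} (ha : a ∈ ends e) : compE ends cls e = cls a := by
  rw [compE, hcls]
  exact reach_of_mem he (Sym2.out_fst_mem _) ha

theorem compE_first (hcls : ∀ u v, cls u = cls v ↔ Reachable ends F u v) {e : ε} {u v : ν}
    (h : FirstEdge ends F u e v) : compE ends cls e = cls u := by
  obtain ⟨he, w, hw, -⟩ := h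
  exact compE_eq hcls he (by rw [hw]; simp)

theorem tree_count (hF : IsAcyclic ends F) (hcls : ∀ u v, cls u = cls v ↔ Reachable ends F u v)
    (hsurj : Function.Surjective cls) (c : Q) :
    (Finset.univ.filter fun v => cls v = c).card =
      (Finset.univ.filter fun e => compE ends cls e = c ∧ e ∈ F).card + 1 := by
  obtain ⟨r, rfl⟩ := hsurj c
  have hr : r ∈ Finset.univ.filter fun v => cls v = cls r := by simp
  rw [← Finset.card_erase_add_one hr]
  congr 1
  have hex : ∀ v ∈ (Finset.univ.filter fun v => cls v = cls r).erase r,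
      ∃ e, FirstEdge ends F v e r := by
    intro v hv
    rw [Finset.mem_erase, Finset.mem_filter, hcls] at hv
    exact firstEdge_exists hv.1 hv.2.2
  choose i hi using hex
  refine Finset.card_bij i ?_ ?_ ?_
  · intro v hv
    rw [Finset.mem_filter]
    refine ⟨Finset.mem_univ _, ?_, (hi v hv).1⟩
    rw [compE_first hcls (hi v hv), hcls]
    exact (hi v hv).reach
  · intro v hv w hw h
    have h1 := hi w hw
    rw [← h] at h1
    exact firstEdge_inj hF (hi v hv) h1
  · intro e he
    rw [Finset.mem_filter] at he
    obtain ⟨-, he1, he2⟩ := he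
    obtain ⟨x, hx⟩ := firstEdge_surj he2 (Sym2.out_fst_mem (ends e)) ((hcls _ _).1 he1)
    have hxm : x ∈ (Finset.univ.filter fun v => cls v = cls r).erase r := by
      rw [Finset.mem_erase, Finset.mem_filter, hcls]
      exact ⟨firstEdge_ne hF hx, Finset.mem_univ _, hx.reach⟩
    exact ⟨x, hxm, firstEdge_unique hF (hi x hxm) hx⟩

theorem num1_compare (hF : IsAcyclic ends F)
    (hcls : ∀ u v, cls u = cls v ↔ Reachable ends F u v)
    (hsurj : Function.Surjective cls) (c : Q) :
    num1 cls (sL ν) c = num1 (compE ends cls) (sR F) c + 1 := by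
  rw [num1_eq _ _ zero_mem_sL, num1_eq _ _ (zero_mem_sR F)]
  simp only [one_mem_sR]
  rw [← tree_count hF hcls hsurj c]
  simp [sL]

theorem numG1_compare (hF : IsAcyclic ends F)
    (hcls : ∀ u v, cls u = cls v ↔ Reachable ends F u v) (sd : ν → Bool) (z : ν)
    (hz : sd z = false) :
    numG1 cls (sL ν) (goodL sd z) (cls z) =
      numG1 (compE ends cls) (sR F) (goodR ends F cls sd z) (cls z) + 1 := by
  rw [numG1_eq _ _ zero_mem_sL, numG1_eq _ _ (zero_mem_sR F)]
  simp only [one_mem_sR]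
  have hL : (Finset.univ.filter fun x => cls x = cls z ∧ 1 ∈ sL ν x ∧
      goodL sd z (cls z) (Pi.single x 1)) =
      insert z (Finset.univ.filter fun x => cls x = cls z ∧ sd x = true) := by
    ext x
    have : goodL sd z (cls z) (Pi.single x 1) ↔ (sd x = true ∨ x = z) := by
      unfold goodL
      have : ∀ v, (if sd v = true ∨ v = z then (Pi.single x 1 : ν → ℕ) v else 0) =
          if v = x then (if sd x = true ∨ x = z then 1 else 0) else 0 := by
        intro v
        by_cases hv : v = x
        · subst hv; simp
        · simp [hv]
      simp only [this, Finset.sum_ite_eq', Finset.mem_univ, if_true]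
      split_ifs with h <;> simp [h]
    simp only [Finset.mem_filter, Finset.mem_univ, true_and, Finset.mem_insert, this]
    constructor
    · rintro ⟨h1, -, h2 | h2⟩
      · exact Or.inr ⟨h1, h2⟩
      · exact Or.inl h2
    · rintro (rfl | ⟨h1, h2⟩)
      · simp [sL]
      · exact ⟨h1, by simp [sL], Or.inl h2⟩
  rw [hL, Finset.card_insert_of_notMem (by simp [hz])]
  congr 1
  have hex : ∀ v ∈ (Finset.univ.filter fun v => cls v = cls z ∧ sd v = true),
      ∃ e, FirstEdge ends F v e z := by
    intro v hv
    rw [Finset.mem_filter, hcls] at hv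
    refine firstEdge_exists ?_ hv.2.1
    rintro rfl
    simp [hz] at hv
  choose i hi using hex
  refine Finset.card_bij i ?_ ?_ ?_
  · intro v hv
    have hf := hi v hv
    rw [Finset.mem_filter] at hv ⊢
    refine ⟨Finset.mem_univ _, ?_, hf.1, ?_, ?_⟩
    · rw [compE_first hcls hf, hcls]
      exact hf.reach
    · exact fun _ => ⟨v, _, hv.2.2, hf, rfl⟩
    · exact fun h => absurd rfl h
  · intro v hv w hw h
    have h1 := hi w hw
    rw [← h] at h1
    exact firstEdge_inj hF (hi v hv) h1
  · intro e he
    rw [Finset.mem_filter] at he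
    obtain ⟨-, he1, he2, he3, -⟩ := he
    obtain ⟨x, e', hx, hxe, hk⟩ := he3 rfl
    have := single_one_inj hk
    subst this
    have hxm : x ∈ (Finset.univ.filter fun v => cls v = cls z ∧ sd v = true) := by
      rw [Finset.mem_filter, hcls]
      exact ⟨Finset.mem_univ _, hxe.reach, hx⟩
    exact ⟨x, hxm, firstEdge_unique hF (hi x hxm) hxe⟩

/-- Pairs of vertices of `c` on different sides. -/
def oppPairs (cls : ν → Q) (sd : ν → Bool) (c : Q) : Finset (ν × ν) :=
  Finset.univ.filter fun p => sd p.1 = true ∧ sd p.2 = false ∧ cls p.1 = c ∧ cls p.2 = c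

theorem numG2_left (cls : ν → Q) (sd : ν → Bool) (z : ν) (c : Q) (hc : c ≠ cls z) :
    numG2 cls (sL ν) (goodL sd z) c = (oppPairs cls sd c).card := by
  symm
  refine Finset.card_bij (fun p _ => Pi.single p.1 1 + Pi.single p.2 1) ?_ ?_ ?_
  · rintro ⟨u, v⟩ hp
    simp only [oppPairs, Finset.mem_filter, Finset.mem_univ, true_and] at hp
    obtain ⟨h1, h2, h3, h4⟩ := hp
    have huv : u ≠ v := by rintro rfl; simp [h1] at h2
    have hvz : v ≠ z := by rintro rfl; exact hc h4.symm
    rw [Finset.mem_filter]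
    refine ⟨?_, by simp [Finset.sum_add_distrib], ?_⟩
    · simp only [locSet, Fintype.mem_piFinset]
      intro x
      by_cases hx : cls x = c
      · simp only [hx, if_true, sL, Finset.mem_range, Pi.add_apply, Pi.single_apply]
        by_cases hxu : x = u
        · subst hxu; simp [huv]
        · simp only [hxu, if_false]; split_ifs <;> simp
      · have hxu : x ≠ u := by rintro rfl; exact hx h3
        have hxv : x ≠ v := by rintro rfl; exact hx h4
        simp [hx, hxu, hxv]
    · unfold goodL
      rw [Finset.sum_eq_single u]
      · simp [h1, huv]
      · intro x _ hxu
        split_ifs with hx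
        · have : x ≠ v := by
            rintro rfl
            rcases hx with hx | hx
            · simp [h2] at hx
            · exact hvz hx
          simp [hxu, this]
        · rfl
      · simp
  · rintro ⟨u, v⟩ hp ⟨u', v'⟩ hp' h
    simp only [oppPairs, Finset.mem_filter, Finset.mem_univ, true_and] at hp hp'
    rcases single_add_inj h with ⟨rfl, rfl⟩ | ⟨rfl, rfl⟩
    · rfl
    · simp [hp.1] at hp'
  · intro k hk
    rw [Finset.mem_filter] at hk
    obtain ⟨hk1, hk2, hk3⟩ := hk
    simp only [locSet, Fintype.mem_piFinset] at hk1
    have hsupp : ∀ x, k x ≠ 0 → cls x = c := by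
      intro x hx
      by_contra hcon
      have := hk1 x
      simp [hcon] at this
      exact hx this
    unfold goodL at hk3
    have hk4 : ∑ v, (if sd v = true ∨ v = z then 0 else k v) = 1 := by
      have : ∑ v, ((if sd v = true ∨ v = z then k v else 0) +
          (if sd v = true ∨ v = z then 0 else k v)) = 2 := by
        rw [← hk2]
        refine Finset.sum_congr rfl fun v _ => ?_
        split_ifs <;> simp
      rw [Finset.sum_add_distrib] at this
      omega
    obtain ⟨u, hu⟩ := eq_single_of_sum_one hk3
    obtain ⟨v, hv⟩ := eq_single_of_sum_one hk4
    have hu1 := congrFun hu u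
    have hv1 := congrFun hv v
    simp only [Pi.single_eq_same] at hu1 hv1
    have hu2 : (sd u = true ∨ u = z) ∧ k u = 1 := by
      split_ifs at hu1 with h
      exact ⟨h, hu1⟩
    have hv2 : ¬ (sd v = true ∨ v = z) ∧ k v = 1 := by
      split_ifs at hv1 with h
      exact ⟨h, hv1⟩
    have hcu := hsupp u (by omega)
    have hcv := hsupp v (by omega)
    refine ⟨(u, v), ?_, ?_⟩
    · simp only [oppPairs, Finset.mem_filter, Finset.mem_univ, true_and]
      refine ⟨?_, ?_, hcu, hcv⟩
      · rcases hu2.1 with h | h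
        · exact h
        · subst h; exact absurd hcu.symm hc
      · have := hv2.1
        push Not at this
        simpa using this.1
    · symm
      refine eq_single_add_of_sum_two hk2 (le_of_eq hu2.2.symm) (le_of_eq hv2.2.symm) ?_
      intro huv
      change u = v at huv
      subst huv
      exact absurd hu2.1 hv2.1

theorem numG2_right (hF : IsAcyclic ends F)
    (hcls : ∀ u v, cls u = cls v ↔ Reachable ends F u v) (sd : ν → Bool) (z : ν) (c : Q)
    (hc : c ≠ cls z) :
    numG2 (compE ends cls) (sR F) (goodR ends F cls sd z) c = (oppPairs cls sd c).card := by
  symm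
  have hex : ∀ p ∈ oppPairs cls sd c, ∃ e f, FirstEdge ends F p.1 e p.2 ∧
      FirstEdge ends F p.2 f p.1 := by
    rintro ⟨u, v⟩ hp
    simp only [oppPairs, Finset.mem_filter, Finset.mem_univ, true_and] at hp ⊢
    obtain ⟨h1, h2, h3, h4⟩ := hp
    have huv : u ≠ v := by rintro rfl; simp [h1] at h2
    have hr : Reachable ends F u v := (hcls _ _).1 (h3.trans h4.symm)
    obtain ⟨e, he⟩ := firstEdge_exists huv hr
    obtain ⟨f, hf⟩ := firstEdge_exists huv.symm (reach_symm hr)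
    exact ⟨e, f, he, hf⟩
  choose i j hi hj using hex
  refine Finset.card_bij (fun p hp => Pi.single (i p hp) 1 + Pi.single (j p hp) 1) ?_ ?_ ?_
  · intro p hp
    have h1 := hi p hp
    have h2 := hj p hp
    generalize i p hp = e at *
    generalize j p hp = f at *
    simp only [oppPairs, Finset.mem_filter, Finset.mem_univ, true_and] at hp
    obtain ⟨g1, g2, g3, g4⟩ := hp
    have c1 := (compE_first hcls h1).trans g3
    have c2 := (compE_first hcls h2).trans g4
    rw [Finset.mem_filter]
    refine ⟨?_, by simp [Finset.sum_add_distrib], fun h => absurd h hc, fun _ =>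
      ⟨p.1, p.2, e, f, g1, g2, g3, h1, h2, rfl⟩⟩
    simp only [locSet, Fintype.mem_piFinset]
    intro x
    by_cases hx : compE ends cls x = c ∧ x ∈ F
    · simp only [hx.1, if_true, sR, hx.2, Finset.mem_range, Pi.add_apply, Pi.single_apply]
      split_ifs <;> simp
    · have hxe : x ≠ e := by rintro rfl; exact hx ⟨c1, h1.1⟩
      have hxf : x ≠ f := by rintro rfl; exact hx ⟨c2, h2.1⟩
      simp only [Pi.add_apply, Pi.single_eq_of_ne hxe, Pi.single_eq_of_ne hxf, add_zero]
      split_ifs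
      · exact zero_mem_sR F x
      · simp
  · intro p hp p' hp' h
    have h1 := hi p hp
    have h2 := hj p hp
    have h1' := hi p' hp'
    have h2' := hj p' hp'
    generalize i p hp = e at *
    generalize j p hp = f at *
    generalize i p' hp' = e' at *
    generalize j p' hp' = f' at *
    obtain ⟨u, v⟩ := p
    obtain ⟨u', v'⟩ := p'
    simp only [oppPairs, Finset.mem_filter, Finset.mem_univ, true_and] at hp hp' h1 h2 h1' h2'
    have huv' : u ≠ v' := by rintro rfl; simp [hp.1] at hp'
    have key : e = e' ∧ f = f' → (u, v) = (u', v') := by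
      rintro ⟨rfl, rfl⟩
      by_cases hef : e = f
      · subst hef
        have k1 := firstEdge_both_ends hF h1 h2
        have k2 := firstEdge_both_ends hF h1' h2'
        rw [k1, Sym2.eq_iff] at k2
        rcases k2 with ⟨rfl, rfl⟩ | ⟨h, -⟩
        · rfl
        · exact absurd h huv'
      · rw [firstEdge_pair_inj hF hef h1 h2 h1' h2',
          firstEdge_pair_inj hF (Ne.symm hef) h2 h1 h2' h1']
    rcases single_add_inj h with h | ⟨rfl, rfl⟩
    · exact key h
    · by_cases hef : e = f
      · exact key ⟨hef, hef.symm⟩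
      · exact absurd (firstEdge_pair_inj hF hef h1 h2 h2' h1') huv'
  · intro k hk
    rw [Finset.mem_filter] at hk
    obtain ⟨hk1, hk2, hk3, hk4⟩ := hk
    obtain ⟨u, v, e, f, g1, g2, g3, h1, h2, rfl⟩ := hk4 hc
    have hp : (u, v) ∈ oppPairs cls sd c := by
      simp only [oppPairs, Finset.mem_filter, Finset.mem_univ, true_and]
      exact ⟨g1, g2, g3, ((hcls _ _).2 h2.reach).trans g3⟩
    refine ⟨(u, v), hp, ?_⟩
    rw [firstEdge_unique hF (hi _ hp) h1, firstEdge_unique hF (hj _ hp) h2]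

/-- The equality of the two generating functions for a fixed forest `F`. -/
theorem forest_sum [Fintype Q] {R : Type} [CommRing R] (hF : IsAcyclic ends F)
    (hcls : ∀ u v, cls u = cls v ↔ Reachable ends F u v)
    (hsurj : Function.Surjective cls) (sd : ν → Bool) (z : ν) (hz : sd z = false) (t : R) :
    ∑ g ∈ (Fintype.piFinset (sL ν)).filter (Valid cls (cls z) (goodL sd z)),
        (t - 1) ^ (Fintype.card Q - ∑ x, g x)
      = ∑ g ∈ (Fintype.piFinset (sR F)).filter
          (Valid (compE ends cls) (cls z) (goodR ends F cls sd z)),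
          t ^ (Fintype.card Q - ∑ x, g x) := by
  refine compare_sum cls (sL ν) zero_mem_sL (compE ends cls) (sR F) (zero_mem_sR F) (cls z)
    _ _ t ?_ ?_ ?_
  · exact fun c _ => num1_compare hF hcls hsurj c
  · intro c hc
    rw [numG2_left cls sd z c hc, numG2_right hF hcls sd z c hc]
  · exact numG1_compare hF hcls sd z hz

theorem card_add_card [Fintype Q] (hF : IsAcyclic ends F)
    (hcls : ∀ u v, cls u = cls v ↔ Reachable ends F u v)
    (hsurj : Function.Surjective cls) : F.card + Fintype.card Q = Fintype.card ν := by
  have h1 : Fintype.card ν = ∑ c : Q, (Finset.univ.filter fun v => cls v = c).card := by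
    rw [← Finset.card_univ]
    exact Finset.card_eq_sum_card_fiberwise (fun _ _ => Finset.mem_univ _)
  have h2 : F.card = ∑ c : Q, (Finset.univ.filter fun e => compE ends cls e = c ∧ e ∈ F).card := by
    rw [Finset.card_eq_sum_card_fiberwise (f := compE ends cls) (t := Finset.univ)
      (fun _ _ => Finset.mem_univ _)]
    refine Finset.sum_congr rfl fun c _ => ?_
    congr 1
    ext e
    simp [and_comm]
  rw [h1, h2, Finset.sum_congr rfl (fun c _ => tree_count hF hcls hsurj c),
    Finset.sum_add_distrib]
  simp

end LocalCounts

/-! ### Part 4: 2-edge-rooted forests as valid edge configurations -/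

section TwoERF

variable (P : BiconedGraph)

theorem side_bot : P.side (⊥ : P.Vred) = false := rfl

theorem acyc_inst {ε ν : Type} {i j : DecidableEq ε} {ends : ε → Sym2 ν} {F : Finset ε} :
    @IsAcyclic ε ν i ends F ↔ @IsAcyclic ε ν j ends F := by
  rw [Subsingleton.elim i j]

/-- The multiplicity function of the forest `F` with edge roots `g`. -/
def multOf {ε : Type} (F : Finset ε) (g : ε → ℕ) : ε → ℕ := fun e => if e ∈ F then g e + 1 else 0

section Abs
variable {ε ν Q : Type} [Fintype ε] [Fintype ν] {ends : ε → Sym2 ν} {F : Finset ε} {cls : ν → Q}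

theorem c3_abs (hF : IsAcyclic ends F)
    (hcls : ∀ u v, cls u = cls v ↔ Reachable ends F u v) (sd : ν → Bool) (z : ν)
    (hz : sd z = false) {g : ε → ℕ} (v : ν)
    (h2 : cnt (compE ends cls) (cls z) (cls v) g = 2) :
    ((Reachable ends F v z →
      ∃ (x : ν) (p : MWalk ends z x), p.IsPath ∧ p.edgesIn F ∧
      (∃ e, p.edges.getLast? = some e ∧ 2 ≤ multOf F g e) ∧ Odd (p.bridgeCount sd)) ∧
    (¬ Reachable ends F v z →
      ∃ (x y : ν) (p : MWalk ends x y), p.IsPath ∧ p.edgesIn F ∧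
      Reachable ends F v x ∧
      (∃ e, p.edges.head? = some e ∧ 2 ≤ multOf F g e) ∧
      (∃ e, p.edges.getLast? = some e ∧ 2 ≤ multOf F g e) ∧
      (∀ e, p.edges = [e] → multOf F g e = 3) ∧
      Odd (p.bridgeCount sd))) ↔
    goodR ends F cls sd z (cls v) (restr (compE ends cls) (cls v) g) := by
  unfold goodR
  rw [← hcls]
  have hm : ∀ e, e ∈ F → multOf F g e = g e + 1 := fun e he => by simp [multOf, he]
  have hk : ∀ e, compE ends cls e = cls v →
      restr (compE ends cls) (cls v) g e = g e := fun e he => by simp [restr, he]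
  unfold cnt at h2
  generalize restr (compE ends cls) (cls v) g = k at h2 hk ⊢
  refine and_congr (forall_congr' fun hc => ?_) (forall_congr' fun hc => ?_)
  · rw [if_pos hc] at h2
    obtain ⟨e0, he0⟩ := eq_single_of_sum_one (k := k) (by omega)
    constructor
    · rintro ⟨x, p, hp, hpF, ⟨e, he, hme⟩, hodd⟩
      have hfe := firstEdge_of_last p hp hpF he
      rw [odd_bridge, hz] at hodd
      refine ⟨x, e, by simpa using hodd, hfe, ?_⟩
      rw [hm e hfe.1] at hme
      have h3 := hk e (((compE_first hcls hfe).trans ((hcls _ _).2 hfe.reach)).trans hc.symm)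
      have : e = e0 := by
        by_contra hne
        rw [he0, Pi.single_eq_of_ne hne] at h3
        omega
      rw [this, he0]
    · rintro ⟨x, e, hx, hfe, hke⟩
      obtain ⟨p, hp, hpF⟩ := exists_path (reach_symm hfe.reach)
      obtain ⟨e', f, he', hf⟩ := path_edges_ne (firstEdge_ne hF hfe).symm p
      have hff := firstEdge_unique hF (firstEdge_of_last p hp hpF hf) hfe
      subst hff
      refine ⟨x, p, hp, hpF, ⟨f, hf, ?_⟩, ?_⟩
      · have h3 := hk f (((compE_first hcls hfe).trans ((hcls _ _).2 hfe.reach)).trans hc.symm)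
        rw [hke, Pi.single_eq_same] at h3
        rw [hm f hfe.1]
        omega
      · rw [odd_bridge, hz, hx]
        simp
  · rw [if_neg hc, add_zero] at h2
    constructor
    · rintro ⟨x, y, p, hp, hpF, hvx, ⟨e, he, hme⟩, ⟨f, hf, hmf⟩, hsing, hodd⟩
      have hfe := firstEdge_of_head p hp hpF he
      have hff := firstEdge_of_last p hp hpF hf
      rw [odd_bridge] at hodd
      have hcx : cls x = cls v := ((hcls _ _).2 hvx).symm
      have hcy : cls y = cls v := ((hcls _ _).2 hff.reach).trans hcx
      have h3 := hk e ((compE_first hcls hfe).trans hcx)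
      have h4 := hk f ((compE_first hcls hff).trans hcy)
      rw [hm e hfe.1] at hme
      rw [hm f hff.1] at hmf
      have hkk : k = Pi.single e 1 + Pi.single f 1 := by
        refine eq_single_add_of_sum_two h2 (by omega) (by omega) ?_
        rintro rfl
        have := hsing e (path_single p hp he hf)
        rw [hm e hfe.1] at this
        omega
      by_cases hs : sd x = true
      · refine ⟨x, y, e, f, hs, ?_, hcx, hfe, hff, hkk⟩
        rw [hs] at hodd
        simpa using hodd.symm
      · rw [Bool.not_eq_true] at hs
        refine ⟨y, x, f, e, ?_, hs, hcy, hff, hfe, by rw [hkk, add_comm]⟩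
        rw [hs] at hodd
        simpa using hodd.symm
    · rintro ⟨x, y, e, f, hsx, hsy, hcx, hfe, hff, hkk⟩
      obtain ⟨p, hp, hpF⟩ := exists_path hfe.reach
      obtain ⟨e', f', he', hf'⟩ := path_edges_ne (firstEdge_ne hF hfe) p
      have h1 := firstEdge_unique hF (firstEdge_of_head p hp hpF he') hfe
      have h2 := firstEdge_unique hF (firstEdge_of_last p hp hpF hf') hff
      subst h1
      subst h2
      have hcy : cls y = cls v := ((hcls _ _).2 hff.reach).trans hcx
      have h3 := hk e' ((compE_first hcls hfe).trans hcx)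
      have h4 := hk f' ((compE_first hcls hff).trans hcy)
      rw [hkk, Pi.add_apply, Pi.single_eq_same] at h3 h4
      refine ⟨x, y, p, hp, hpF, (hcls _ _).1 hcx.symm, ⟨e', he', ?_⟩, ⟨f', hf', ?_⟩, ?_, ?_⟩
      · rw [hm _ hfe.1]; omega
      · rw [hm _ hff.1]; omega
      · intro e'' hs
        rw [hs] at he' hf'
        simp only [List.head?_cons, Option.some.injEq, List.getLast?_singleton] at he' hf'
        subst he'
        subst hf'
        rw [hm _ hfe.1]
        rw [Pi.single_eq_same] at h3
        omega
      · rw [odd_bridge, hsx, hsy]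
        simp


end Abs

theorem mSupport_multOf (F : Finset P.Ered) (g : P.Ered → ℕ) :
    P.mSupport (multOf F g) = F := by
  ext e
  simp [BiconedGraph.mSupport, multOf]

variable {P} {Q : Type} {F : Finset P.Ered} {cls : P.Vred → Q}

theorem compCount_eq (hcls : ∀ u v, cls u = cls v ↔ Reachable P.endsRed F u v)
    {g : P.Ered → ℕ} (hg : ∀ e, e ∉ F → g e = 0) (v : P.Vred) :
    P.compCount (multOf F g) v = cnt (compE P.endsRed cls) (cls ⊥) (cls v) g := by
  unfold BiconedGraph.compCount BiconedGraph.compEdgeRoots cnt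
  rw [mSupport_multOf]
  congr 1
  · rw [← Finset.sum_subset (Finset.subset_univ F)]
    · refine Finset.sum_congr rfl fun e he => ?_
      have : P.Touches F v e ↔ compE P.endsRed cls e = cls v := by
        constructor
        · rintro ⟨u, hu, hr⟩
          rw [compE_eq hcls he hu, hcls]
          exact reach_symm hr
        · intro h
          refine ⟨_, Sym2.out_fst_mem _, ?_⟩
          rw [← hcls]
          exact h.symm
      simp [this, restr, multOf, he]
    · intro e _ he
      simp [restr, hg e he]
  · simp only [hcls]

theorem c3At_iff (hF : IsAcyclic P.endsRed F)
    (hcls : ∀ u v, cls u = cls v ↔ Reachable P.endsRed F u v)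
    {g : P.Ered → ℕ} (v : P.Vred)
    (h2 : cnt (compE P.endsRed cls) (cls ⊥) (cls v) g = 2) :
    P.C3At (multOf F g) v ↔ goodR P.endsRed F cls P.side ⊥ (cls v)
      (restr (compE P.endsRed cls) (cls v) g) := by
  unfold BiconedGraph.C3At
  rw [mSupport_multOf]
  exact c3_abs (acyc_inst.1 hF) hcls P.side ⊥ (side_bot P) v h2

theorem is2ERF_iff (hF : IsAcyclic P.endsRed F)
    (hcls : ∀ u v, cls u = cls v ↔ Reachable P.endsRed F u v)
    (hsurj : Function.Surjective cls)
    {g : P.Ered → ℕ} (hg : ∀ e, e ∉ F → g e = 0) :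
    P.Is2ERF (multOf F g) ↔
      Valid (compE P.endsRed cls) (cls ⊥) (goodR P.endsRed F cls P.side ⊥) g := by
  unfold BiconedGraph.Is2ERF Valid
  simp only [compCount_eq hcls hg, hsurj.forall]
  rw [mSupport_multOf]
  constructor
  · rintro ⟨-, h1, h2, h3⟩
    exact ⟨h1, fun u v hu hv => (hcls _ _).2 (h2 u v hu hv),
      fun v hv => (c3At_iff hF hcls v hv).1 (h3 v hv)⟩
  · rintro ⟨h1, h2, h3⟩
    exact ⟨hF, h1, fun u v hu hv => (hcls _ _).1 (h2 u v hu hv),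
      fun v hv => (c3At_iff hF hcls v hv).2 (h3 v hv)⟩

end TwoERF

/-! ### Part 5: acyclic sets of the biconed graph as valid vertex configurations -/

section LHS

theorem card_filter_le_one {ι Q : Type} {D : Finset ι} {f : ι → Q} {c : Q} :
    (D.filter fun v => f v = c).card ≤ 1 ↔ ∀ i ∈ D, ∀ j ∈ D, f i = c → f j = c → i = j := by
  rw [Finset.card_le_one]
  simp only [Finset.mem_filter]
  exact ⟨fun h i hi j hj h1 h2 => h i ⟨hi, h1⟩ j ⟨hj, h2⟩,
    fun h i hi j hj => h i hi.1 j hj.1 hi.2 hj.2⟩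

theorem card_filter_pos_iff {ι Q : Type} {D : Finset ι} {f : ι → Q} {c : Q} :
    1 ≤ (D.filter fun v => f v = c).card ↔ ∃ i ∈ D, f i = c := by
  rw [Nat.succ_le_iff, Finset.card_pos]
  simp [Finset.Nonempty]

/-- The indicator configuration of a vertex set. -/
def ind {ν : Type} (C : Finset ν) : ν → ℕ := fun v => if v ∈ C then 1 else 0

variable {ε ν Q : Type} [Fintype ν]

theorem valid_ind (cls : ν → Q) (sd : ν → Bool) (z : ν) (C CA CB : Finset ν)
    (hCA : CA = C.filter fun v => sd v = true ∨ v = z)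
    (hCB : CB = C.filter fun v => ¬ (sd v = true ∨ v = z)) :
    Valid cls (cls z) (goodL sd z) (ind C) ↔
      ((∀ b ∈ CB, cls z ≠ cls b) ∧ (∀ b ∈ CB, ∀ b' ∈ CB, b ≠ b' → cls b ≠ cls b')) ∧
      (∀ a ∈ CA, ∀ a' ∈ CA, a ≠ a' → ¬ (cls a = cls a' ∨
        ((cls a = cls z ∨ ∃ b ∈ CB, cls a = cls b) ∧
         (cls a' = cls z ∨ ∃ b ∈ CB, cls a' = cls b)))) := by
  have hA : ∀ c, goodL sd z c (restr cls c (ind C)) ↔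
      (CA.filter fun v => cls v = c).card = 1 := by
    intro c
    unfold goodL
    rw [hCA, Finset.card_filter, Finset.sum_filter]
    rw [← Finset.sum_subset (Finset.subset_univ C)]
    · rw [Finset.sum_congr rfl]
      intro x hx
      simp [restr, ind, hx]
    · intro x _ hx
      simp [restr, ind, hx]
  have hcnt : ∀ c, cnt cls (cls z) c (ind C) = (CA.filter fun v => cls v = c).card +
      ((CB.filter fun v => cls v = c).card + if c = cls z then 1 else 0) := by
    intro c
    unfold cnt
    rw [← add_assoc]
    congr 1
    have : ∑ x, restr cls c (ind C) x = (C.filter fun v => cls v = c).card := by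
      simp only [restr, ind]
      rw [Finset.card_filter, ← Finset.sum_subset (Finset.subset_univ C)]
      · exact Finset.sum_congr rfl fun x hx => by simp [hx]
      · intro x _ hx
        simp [hx]
    rw [this, ← Finset.card_filter_add_card_filter_not (s := C.filter fun v => cls v = c)
      (fun v => sd v = true ∨ v = z)]
    rw [hCA, hCB, Finset.filter_comm, Finset.filter_comm (p := fun v => cls v = c)]
  have hM : ∀ c, (c = cls z ∨ ∃ b ∈ CB, c = cls b) ↔
      1 ≤ (CB.filter fun v => cls v = c).card + if c = cls z then 1 else 0 := by
    intro c
    have := card_filter_pos_iff (D := CB) (f := cls) (c := c)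
    simp only [eq_comm (a := c), ← this]
    split_ifs with h
    · simp [h]
    · simp [h]
  have h1 : ((∀ b ∈ CB, cls z ≠ cls b) ∧ (∀ b ∈ CB, ∀ b' ∈ CB, b ≠ b' → cls b ≠ cls b')) ↔
      ∀ c, (CB.filter fun v => cls v = c).card + (if c = cls z then 1 else 0) ≤ 1 := by
    constructor
    · rintro ⟨h1, h2⟩ c
      have h3 : (CB.filter fun v => cls v = c).card ≤ 1 := card_filter_le_one.2
        fun i hi j hj hic hjc => by_contra fun hne => h2 i hi j hj hne (hic.trans hjc.symm)
      split_ifs with h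
      · have : ¬ 1 ≤ (CB.filter fun v => cls v = c).card := by
          rw [card_filter_pos_iff]
          rintro ⟨b, hb, hbc⟩
          exact h1 b hb (h.symm.trans hbc.symm)
        omega
      · omega
    · intro h
      constructor
      · intro b hb hzb
        have h3 := h (cls b)
        have h4 := (card_filter_pos_iff (D := CB) (f := cls)).2 ⟨b, hb, rfl⟩
        rw [if_pos hzb.symm] at h3
        omega
      · intro b hb b' hb' hne hbb
        exact hne (card_filter_le_one.1 ((Nat.le_add_right _ _).trans (h (cls b))) b hb b' hb' rfl
          hbb.symm)
  rw [h1]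
  simp only [hM]
  unfold Valid
  simp only [hcnt, hA]
  constructor
  · rintro ⟨v1, v2, v3⟩
    have k1 : ∀ c, (CA.filter fun v => cls v = c).card ≤ 1 := by
      intro c
      have := v1 c
      have := v3 c
      omega
    have k2 : ∀ c, (CB.filter fun v => cls v = c).card + (if c = cls z then 1 else 0) ≤ 1 := by
      intro c
      have := v1 c
      have := v3 c
      omega
    refine ⟨k2, ?_⟩
    have k3 : ∀ a ∈ CA, ∀ a' ∈ CA, a ≠ a' → cls a ≠ cls a' := fun a ha a' ha' hne h =>
      hne (card_filter_le_one.1 (k1 (cls a)) a ha a' ha' rfl h.symm)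
    rintro a ha a' ha' hne (h | ⟨h, h'⟩)
    · exact k3 a ha a' ha' hne h
    · refine k3 a ha a' ha' hne (v2 _ _ ?_ ?_)
      · have := k1 (cls a)
        have := k2 (cls a)
        have := (card_filter_pos_iff (D := CA) (f := cls)).2 ⟨a, ha, rfl⟩
        omega
      · have := k1 (cls a')
        have := k2 (cls a')
        have := (card_filter_pos_iff (D := CA) (f := cls)).2 ⟨a', ha', rfl⟩
        omega
  · rintro ⟨k2, k⟩
    have k1 : ∀ c, (CA.filter fun v => cls v = c).card ≤ 1 := fun c => card_filter_le_one.2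
      fun i hi j hj hic hjc => by_contra fun hne => k i hi j hj hne (Or.inl (hic.trans hjc.symm))
    refine ⟨fun c => ?_, fun c c' h h' => ?_, fun c h => ?_⟩
    · have := k1 c
      have := k2 c
      omega
    · have e1 := k1 c
      have e2 := k2 c
      have e3 := k1 c'
      have e4 := k2 c'
      obtain ⟨a, ha, rfl⟩ := (card_filter_pos_iff (D := CA) (f := cls) (c := c)).1 (by omega)
      obtain ⟨a', ha', rfl⟩ := (card_filter_pos_iff (D := CA) (f := cls) (c := c')).1 (by omega)
      by_contra hne
      exact k a ha a' ha' (fun h => hne (by rw [h])) (Or.inr ⟨by omega, by omega⟩)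
    · have := k1 c
      have := k2 c
      omega

theorem acyc_bicone {εB W : Type} {ends : ε → Sym2 ν} {endsB : εB → Sym2 W}
    {F : Finset ε} {cls : ν → Q} (hcls : ∀ u v, cls u = cls v ↔ Reachable ends F u v)
    (sd : ν → Bool) (z : ν) (φ : ν → W) (hφ : Function.Injective φ) (top : W)
    (htop : ∀ v, φ v ≠ top) (redE : ε ↪ εB) (tE : ν ↪ εB) (hdisj : ∀ v e, redE e ≠ tE v)
    (hred : ∀ e, endsB (redE e) = (ends e).map φ)
    (htA : ∀ v, (sd v = true ∨ v = z) → endsB (tE v) = s(top, φ v))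
    (htB : ∀ v, ¬ (sd v = true ∨ v = z) → endsB (tE v) = s(φ z, φ v))
    (C : Finset ν) :
    IsAcyclic endsB (C.map tE ∪ F.map redE) ↔
      IsAcyclic ends F ∧ Valid cls (cls z) (goodL sd z) (ind C) := by
  obtain ⟨CA, hCA⟩ : ∃ D, D = C.filter fun v => sd v = true ∨ v = z := ⟨_, rfl⟩
  obtain ⟨CB, hCB⟩ : ∃ D, D = C.filter fun v => ¬ (sd v = true ∨ v = z) := ⟨_, rfl⟩
  rw [valid_ind cls sd z C CA CB hCA hCB]
  have hC : C.map tE ∪ F.map redE = CA.map tE ∪ (CB.map tE ∪ F.map redE) := by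
    rw [← Finset.union_assoc, ← Finset.map_union, hCA, hCB, Finset.filter_union_filter_not_eq]
  have mB : ∀ i ∈ CB, ¬ (sd i = true ∨ i = z) := fun i hi => by
    rw [hCB, Finset.mem_filter] at hi
    exact hi.2
  have mA : ∀ i ∈ CA, sd i = true ∨ i = z := fun i hi => by
    rw [hCA, Finset.mem_filter] at hi
    exact hi.2
  have hB : ∀ i ∈ CB, endsB (tE i) = s(φ z, φ i) := fun i hi => htB i (mB i hi)
  have hA : ∀ i ∈ CA, endsB (tE i) = s(top, φ i) := fun i hi => htA i (mA i hi)
  have hr : ∀ u v, Reachable endsB (F.map redE) (φ u) (φ v) ↔ cls u = cls v := fun u v => by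
    rw [reach_map' redE φ hφ hred, hcls]
  have hrt : ∀ u, ¬ Reachable endsB (F.map redE) (φ u) top := fun u => by
    rw [reach_map redE φ hφ hred]
    rintro ⟨v, hv, -⟩
    exact htop v hv.symm
  have hnF : ∀ i, tE i ∉ F.map redE := by
    intro i hi
    obtain ⟨e, -, he⟩ := Finset.mem_map.1 hi
    exact hdisj i e he
  have hrt' : ∀ u, ¬ Reachable endsB (F.map redE) top (φ u) := fun u h => hrt u (reach_symm h)
  rw [hC, acyc_star CA tE φ top hA, acyc_star CB tE φ (φ z) hB (fun i _ => hnF i),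
    acyc_map redE φ hφ hred]
  · simp only [reach_star CB tE φ (φ z) hB, hr, hrt']
    simp only [exists_false, and_false, not_false_eq_true, false_and, or_self,
      implies_true, true_and]
    rw [and_assoc]
  · intro i hi h
    rw [Finset.mem_union] at h
    rcases h with h | h
    · rw [Finset.mem_map' tE] at h
      exact mB i h (mA i hi)
    · exact hnF i h

end LHS

/-! ### Part 6: summing over all forests -/

section Total

theorem sum_by_degree {α : Type} (s : Finset α) (dg : α → ℕ) (d : ℕ) (hd : ∀ a ∈ s, dg a ≤ d)
    (y : Polynomial ℤ) :
    ∑ i ∈ Finset.range (d + 1),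
      Polynomial.C (((s.filter fun a => dg a = i).card : ℤ)) * y ^ (d - i)
      = ∑ a ∈ s, y ^ (d - dg a) := by
  rw [← Finset.sum_fiberwise_of_maps_to (s := s) (t := Finset.range (d + 1)) (g := dg)
    (fun a ha => Finset.mem_range.2 (Nat.lt_succ_of_le (hd a ha)))]
  refine Finset.sum_congr rfl fun i _ => ?_
  rw [Finset.sum_congr rfl (g := fun _ => y ^ (d - i))
    (fun a ha => by rw [(Finset.mem_filter.1 ha).2])]
  simp

variable {ε ν : Type}

/-- Connectivity by edges of `F`. -/
def reachSetoid (ends : ε → Sym2 ν) (F : Finset ε) : Setoid ν :=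
  ⟨Reachable ends F, ⟨reach_refl, reach_symm, reach_trans⟩⟩

/-- The set of components. -/
abbrev Comp (ends : ε → Sym2 ν) (F : Finset ε) : Type := Quotient (reachSetoid ends F)

/-- The component of a vertex. -/
def clsF (ends : ε → Sym2 ν) (F : Finset ε) (v : ν) : Comp ends F := Quotient.mk _ v

theorem clsF_iff (ends : ε → Sym2 ν) (F : Finset ε) (u v : ν) :
    clsF ends F u = clsF ends F v ↔ Reachable ends F u v := Quotient.eq

theorem clsF_surj (ends : ε → Sym2 ν) (F : Finset ε) : Function.Surjective (clsF ends F) :=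
  Quotient.mk_surjective

variable [Fintype ε] [Fintype ν]

theorem sum_ind (C : Finset ν) : ∑ v, ind C v = C.card := by
  simp [ind]

/-- Summation over vertex sets versus 0/1-configurations. -/
theorem sum_sL {R : Type} [CommRing R] (p : (ν → ℕ) → Prop) (f : ℕ → R) :
    ∑ C ∈ Finset.univ.filter (fun C : Finset ν => p (ind C)), f C.card
      = ∑ g ∈ (Fintype.piFinset (sL ν)).filter p, f (∑ v, g v) := by
  refine Finset.sum_bij' (fun C _ => ind C) (fun g _ => Finset.univ.filter fun v => g v ≠ 0)
    ?_ ?_ ?_ ?_ ?_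
  · intro C hC
    simp only [Finset.mem_filter, Finset.mem_univ, true_and] at hC
    refine Finset.mem_filter.2 ⟨?_, hC⟩
    rw [Fintype.mem_piFinset]
    intro v
    simp only [sL, ind, Finset.mem_range]
    split_ifs <;> omega
  · intro g hg
    have hg' : ind (Finset.univ.filter fun v => g v ≠ 0) = g := by
      rw [Finset.mem_filter, Fintype.mem_piFinset] at hg
      funext v
      have := hg.1 v
      simp only [sL, Finset.mem_range] at this
      simp only [ind, Finset.mem_filter, Finset.mem_univ, true_and]
      split_ifs <;> omega
    simp only [Finset.mem_filter, Finset.mem_univ, true_and, hg']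
    exact (Finset.mem_filter.1 hg).2
  · intro C _
    ext v
    simp [ind]
  · intro g hg
    rw [Finset.mem_filter, Fintype.mem_piFinset] at hg
    funext v
    have := hg.1 v
    simp only [sL, Finset.mem_range] at this
    simp only [ind, Finset.mem_filter, Finset.mem_univ, true_and]
    split_ifs <;> omega
  · intro C _
    rw [sum_ind]

variable {εB W : Type} [Fintype εB] {ends : ε → Sym2 ν} {endsB : εB → Sym2 W}

/-- The valid edge-root configurations on the forest `F`. -/
def validR (ends : ε → Sym2 ν) (sd : ν → Bool) (z : ν) (F : Finset ε) : Finset (ε → ℕ) :=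
  (Fintype.piFinset (sR F)).filter
    (Valid (compE ends (clsF ends F)) (clsF ends F z) (goodR ends F (clsF ends F) sd z))

theorem mem_validR {sd : ν → Bool} {z : ν} {F : Finset ε} {g : ε → ℕ} :
    g ∈ validR ends sd z F ↔ (∀ e, g e ∈ sR F e) ∧
      Valid (compE ends (clsF ends F)) (clsF ends F z) (goodR ends F (clsF ends F) sd z) g := by
  unfold validR
  rw [Finset.mem_filter, Fintype.mem_piFinset]

theorem deg_le_of_validR {sd : ν → Bool} {z : ν} {F : Finset ε} (hF : IsAcyclic ends F)
    {g : ε → ℕ} (hg : g ∈ validR ends sd z F) : F.card + ∑ e, g e ≤ Fintype.card ν := by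
  have h1 := valid_sum_le (Finset.mem_filter.1 hg).2
  have h2 := card_add_card hF (clsF_iff ends F) (clsF_surj ends F)
  omega

theorem total_abs
    (sd : ν → Bool) (z : ν) (hz : sd z = false) (φ : ν → W) (hφ : Function.Injective φ) (top : W)
    (htop : ∀ v, φ v ≠ top) (redE : ε ↪ εB) (tE : ν ↪ εB) (hdisj : ∀ v e, redE e ≠ tE v)
    (hcov : ∀ x, (∃ e, redE e = x) ∨ ∃ v, tE v = x)
    (hred : ∀ e, endsB (redE e) = (ends e).map φ)
    (htA : ∀ v, (sd v = true ∨ v = z) → endsB (tE v) = s(top, φ v))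
    (htB : ∀ v, ¬ (sd v = true ∨ v = z) → endsB (tE v) = s(φ z, φ v)) :
    (∀ H : Finset εB, IsAcyclic endsB H → H.card ≤ Fintype.card ν) ∧
    ∑ H ∈ Finset.univ.filter (fun H : Finset εB => IsAcyclic endsB H),
        (Polynomial.X - 1 : Polynomial ℤ) ^ (Fintype.card ν - H.card)
      = ∑ F ∈ Finset.univ.filter (fun F : Finset ε => IsAcyclic ends F),
          ∑ g ∈ validR ends sd z F, Polynomial.X ^ (Fintype.card ν - (F.card + ∑ e, g e)) := by
  have hac : ∀ (C : Finset ν) (F : Finset ε), IsAcyclic endsB (C.map tE ∪ F.map redE) ↔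
      IsAcyclic ends F ∧ Valid (clsF ends F) (clsF ends F z) (goodL sd z) (ind C) := fun C F =>
    acyc_bicone (clsF_iff ends F) sd z φ hφ top htop redE tE hdisj hred htA htB C
  have hdec : ∀ H : Finset εB, (Finset.univ.filter fun v => tE v ∈ H).map tE ∪
      (Finset.univ.filter fun e => redE e ∈ H).map redE = H := by
    intro H
    ext x
    simp only [Finset.mem_union, Finset.mem_map, Finset.mem_filter, Finset.mem_univ, true_and]
    constructor
    · rintro (⟨v, hv, rfl⟩ | ⟨e, he, rfl⟩) <;> assumption
    · intro hx
      rcases hcov x with ⟨e, rfl⟩ | ⟨v, rfl⟩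
      · exact Or.inr ⟨e, hx, rfl⟩
      · exact Or.inl ⟨v, hx, rfl⟩
  have hdC : ∀ (C : Finset ν) (F : Finset ε),
      (Finset.univ.filter fun v => tE v ∈ C.map tE ∪ F.map redE) = C := by
    intro C F
    ext v
    simp [hdisj]
  have hdF : ∀ (C : Finset ν) (F : Finset ε),
      (Finset.univ.filter fun e => redE e ∈ C.map tE ∪ F.map redE) = F := by
    intro C F
    ext e
    simp [fun v e => (hdisj v e).symm]
  have hcard : ∀ (C : Finset ν) (F : Finset ε),
      (C.map tE ∪ F.map redE).card = C.card + F.card := by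
    intro C F
    rw [Finset.card_union_of_disjoint, Finset.card_map, Finset.card_map]
    rw [Finset.disjoint_left]
    intro x hx hx'
    obtain ⟨v, -, rfl⟩ := Finset.mem_map.1 hx
    obtain ⟨e, -, he⟩ := Finset.mem_map.1 hx'
    exact hdisj v e he
  constructor
  · intro H hH
    rw [← hdec H] at hH ⊢
    rw [hcard]
    obtain ⟨h1, h2⟩ := (hac _ _).1 hH
    have h3 := valid_sum_le h2
    rw [sum_ind] at h3
    have h4 := card_add_card h1 (clsF_iff ends _) (clsF_surj ends _)
    omega
  · have key : ∑ H ∈ Finset.univ.filter (fun H : Finset εB => IsAcyclic endsB H),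
        (Polynomial.X - 1 : Polynomial ℤ) ^ (Fintype.card ν - H.card)
      = ∑ F ∈ Finset.univ.filter (fun F : Finset ε => IsAcyclic ends F),
          ∑ C ∈ Finset.univ.filter (fun C : Finset ν =>
              Valid (clsF ends F) (clsF ends F z) (goodL sd z) (ind C)),
            (Polynomial.X - 1 : Polynomial ℤ) ^ (Fintype.card ν - (C.card + F.card)) := by
      rw [Finset.sum_sigma']
      symm
      refine Finset.sum_bij' (fun x _ => x.2.map tE ∪ x.1.map redE)
        (fun H _ => ⟨Finset.univ.filter fun e => redE e ∈ H,
          Finset.univ.filter fun v => tE v ∈ H⟩) ?_ ?_ ?_ ?_ ?_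
      · rintro ⟨F, C⟩ h
        simp only [Finset.mem_sigma, Finset.mem_filter, Finset.mem_univ, true_and] at h ⊢
        exact (hac C F).2 h
      · intro H h
        simp only [Finset.mem_sigma, Finset.mem_filter, Finset.mem_univ, true_and] at h ⊢
        rw [← hac, hdec]
        exact h
      · rintro ⟨F, C⟩ h
        simp only [hdC, hdF]
      · intro H h
        exact hdec H
      · rintro ⟨F, C⟩ h
        simp only [hcard]
    rw [key]
    refine Finset.sum_congr rfl fun F hF => ?_
    replace hF := (Finset.mem_filter.1 hF).2
    have hQ := card_add_card hF (clsF_iff ends F) (clsF_surj ends F)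
    rw [sum_sL (Valid (clsF ends F) (clsF ends F z) (goodL sd z))
      (fun k => (Polynomial.X - 1 : Polynomial ℤ) ^ (Fintype.card ν - (k + F.card)))]
    have := forest_sum hF (clsF_iff ends F) (clsF_surj ends F) sd z hz (Polynomial.X : Polynomial ℤ)
    refine (Finset.sum_congr rfl fun g _ => ?_).trans (this.trans ?_)
    · rw [show Fintype.card ν - ((∑ v, g v) + F.card) =
        Fintype.card (Comp ends F) - ∑ v, g v by omega]
    · unfold validR
      refine Finset.sum_congr rfl fun g _ => ?_
      rw [show Fintype.card ν - (F.card + ∑ e, g e) =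
        Fintype.card (Comp ends F) - ∑ e, g e by omega]

end Total

/-! ### Part 7: the biconed graph -/

section Final

variable (P : BiconedGraph)

theorem vred_cases (p : P.Vred → Prop) (h0 : p ⊥) (hA : ∀ a, p (P.liftV (P.aVert a)))
    (hB : ∀ b, p (P.liftV (P.bVert b))) (v : P.Vred) : p v := by
  induction v using WithBot.recBotCoe with
  | bot => exact h0
  | coe x =>
    obtain ⟨y, rfl⟩ := toLex.surjective x
    rcases y with a | b
    · exact hA a
    · exact hB b

/-- The edge of `T₀` joining `v` to its parent. -/
def tFun : P.Vred → P.EB :=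
  WithBot.recBotCoe P.e00 fun x => Sum.elim (fun a => P.eA a) (fun b => P.eB b) (ofLex x)

theorem tFun_bot : tFun P ⊥ = P.e00 := rfl
theorem tFun_a (a : Fin P.m) : tFun P (P.liftV (P.aVert a)) = P.eA a := rfl
theorem tFun_b (b : Fin P.n) : tFun P (P.liftV (P.bVert b)) = P.eB b := rfl
theorem side_a (a : Fin P.m) : P.side (P.liftV (P.aVert a)) = true := rfl
theorem side_b (b : Fin P.n) : P.side (P.liftV (P.bVert b)) = false := rfl

theorem tFun_inj : Function.Injective (tFun P) := by
  refine vred_cases P (fun u => ∀ ⦃v⦄, tFun P u = tFun P v → u = v) ?_ ?_ ?_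
  · refine vred_cases P _ ?_ ?_ ?_ <;> simp [tFun_bot, tFun_a, tFun_b]
  · intro a
    refine vred_cases P _ ?_ ?_ ?_ <;> simp +contextual [tFun_bot, tFun_a, tFun_b]
  · intro b
    refine vred_cases P _ ?_ ?_ ?_ <;> simp +contextual [tFun_bot, tFun_a, tFun_b]

theorem redToEB_inj : Function.Injective P.redToEB := by
  rintro (a | e) (b | f) h <;> simp_all [BiconedGraph.redToEB]

theorem card_vred : Fintype.card P.Vred = P.d := by
  have : Fintype.card P.Vred = Fintype.card (Option (Fin P.m ⊕ Fin P.n)) :=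
    Fintype.card_congr (Equiv.refl _)
  rw [this]
  simp [BiconedGraph.d]

theorem total_P :
    (∀ H : Finset P.EB, IsAcyclic P.endsB H → H.card ≤ Fintype.card P.Vred) ∧
    ∑ H ∈ Finset.univ.filter (fun H : Finset P.EB => IsAcyclic P.endsB H),
        (Polynomial.X - 1 : Polynomial ℤ) ^ (Fintype.card P.Vred - H.card)
      = ∑ F ∈ Finset.univ.filter (fun F : Finset P.Ered => IsAcyclic P.endsRed F),
          ∑ g ∈ validR P.endsRed P.side ⊥ F,
            Polynomial.X ^ (Fintype.card P.Vred - (F.card + ∑ e, g e)) := by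
  have := total_abs (ends := P.endsRed) (endsB := P.endsB) P.side ⊥ (side_bot P) P.liftW
    WithBot.coe_injective ⊥ (fun v => WithBot.coe_ne_bot) ⟨P.redToEB, redToEB_inj P⟩
    ⟨tFun P, tFun_inj P⟩ ?_ ?_ ?_ ?_ ?_
  · convert this
  · refine vred_cases P _ ?_ ?_ ?_
    · rintro (a | e) <;> simp [tFun_bot, BiconedGraph.redToEB]
    · rintro a (a | e) <;> simp [tFun_a, BiconedGraph.redToEB]
    · rintro a (a | e) <;> simp [tFun_b, BiconedGraph.redToEB]
  · rintro (_ | a | b | a | e)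
    · exact Or.inr ⟨⊥, rfl⟩
    · exact Or.inr ⟨P.liftV (P.aVert a), rfl⟩
    · exact Or.inr ⟨P.liftV (P.bVert b), rfl⟩
    · exact Or.inl ⟨Sum.inl a, rfl⟩
    · exact Or.inl ⟨Sum.inr e, rfl⟩
  · rintro (a | e)
    · rfl
    · simp only [Function.Embedding.coeFn_mk, BiconedGraph.redToEB, BiconedGraph.endsB,
        BiconedGraph.endsRed, Sym2.map_map]
      rfl
  · refine vred_cases P _ ?_ ?_ ?_
    · intro _
      rfl
    · intro a _
      rfl
    · rintro b (h | h)
      · rw [side_b] at h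
        cases h
      · exact absurd h WithBot.coe_ne_bot
  · refine vred_cases P _ ?_ ?_ ?_
    · intro h
      exact absurd (Or.inr rfl) h
    · intro a h
      exact absurd (Or.inl (side_a P a)) h
    · intro b _
      rfl

/-- All 2-edge-rooted forests, as a finset. -/
def all2 : Finset (P.Ered → ℕ) :=
  (Fintype.piFinset fun _ => Finset.range 4).filter P.Is2ERF

variable {P}

theorem multOf_self (mult : P.Ered → ℕ) :
    multOf (P.mSupport mult) (fun e => mult e - 1) = mult := by
  funext e
  simp only [multOf, BiconedGraph.mSupport, Finset.mem_filter, Finset.mem_univ, true_and]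
  split_ifs <;> omega

theorem is2ERF_validR (F : Finset P.Ered) (g : P.Ered → ℕ) (hg : ∀ e, e ∉ F → g e = 0) :
    P.Is2ERF (multOf F g) ↔ IsAcyclic P.endsRed F ∧ g ∈ validR P.endsRed P.side ⊥ F := by
  by_cases hF : IsAcyclic P.endsRed F
  · rw [is2ERF_iff hF (clsF_iff P.endsRed F) (clsF_surj P.endsRed F) hg]
    rw [mem_validR]
    constructor
    · intro h
      refine ⟨hF, ?_, h⟩
      intro e
      unfold sR
      split_ifs with he
      · rw [Finset.mem_range, Nat.lt_succ_iff]
        refine le_trans ?_ (h.1 (compE P.endsRed (clsF P.endsRed F) e))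
        unfold cnt
        refine le_trans ?_ (Nat.le_add_right _ _)
        refine le_trans ?_ (Finset.single_le_sum (fun _ _ => Nat.zero_le _) (Finset.mem_univ e))
        simp [restr]
      · simpa using hg e he
    · exact fun h => h.2.2
  · constructor
    · intro h
      have := h.1
      rw [mSupport_multOf] at this
      exact absurd this hF
    · exact fun h => absurd h.1 hF

theorem validR_zero {F : Finset P.Ered} {g : P.Ered → ℕ} (h : g ∈ validR P.endsRed P.side ⊥ F) :
    (∀ e, e ∉ F → g e = 0) ∧ ∀ e, g e < 3 := by
  have h1 := (mem_validR.1 h).1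
  constructor
  · intro e he
    have := h1 e
    simpa [sR, he] using this
  · intro e
    have := h1 e
    unfold sR at this
    split_ifs at this
    · simpa using this
    · simp only [Finset.mem_singleton] at this
      omega

theorem deg_multOf {F : Finset P.Ered} {g : P.Ered → ℕ} (hg : ∀ e, e ∉ F → g e = 0) :
    P.deg (multOf F g) = F.card + ∑ e, g e := by
  unfold BiconedGraph.deg
  have : ∀ e, multOf F g e = (if e ∈ F then 1 else 0) + g e := by
    intro e
    unfold multOf
    split_ifs with he
    · omega
    · rw [hg e he]
  simp only [this, Finset.sum_add_distrib]
  simp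

theorem mem_all2 {mult : P.Ered → ℕ} : mult ∈ all2 P ↔ P.Is2ERF mult := by
  unfold all2
  rw [Finset.mem_filter]
  refine ⟨fun h => h.2, fun h => ⟨?_, h⟩⟩
  rw [Fintype.mem_piFinset]
  intro e
  have h1 : ∀ e, e ∉ P.mSupport mult → mult e - 1 = 0 := by
    intro e he
    simp only [BiconedGraph.mSupport, Finset.mem_filter, Finset.mem_univ, true_and,
      not_not] at he
    omega
  rw [← multOf_self mult, is2ERF_validR _ _ h1] at h
  have := (validR_zero h.2).2 e
  rw [Finset.mem_range]
  omega

theorem deg_le {mult : P.Ered → ℕ} (h : P.Is2ERF mult) : P.deg mult ≤ Fintype.card P.Vred := by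
  have h1 : ∀ e, e ∉ P.mSupport mult → mult e - 1 = 0 := by
    intro e he
    simp only [BiconedGraph.mSupport, Finset.mem_filter, Finset.mem_univ, true_and,
      not_not] at he
    omega
  rw [← multOf_self mult] at h ⊢
  rw [is2ERF_validR _ _ h1] at h
  rw [deg_multOf h1]
  exact deg_le_of_validR (acyc_inst.1 h.1) h.2

theorem sum_all2 (y : Polynomial ℤ) :
    ∑ F ∈ Finset.univ.filter (fun F : Finset P.Ered => IsAcyclic P.endsRed F),
          ∑ g ∈ validR P.endsRed P.side ⊥ F,
            y ^ (Fintype.card P.Vred - (F.card + ∑ e, g e))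
      = ∑ mult ∈ all2 P, y ^ (Fintype.card P.Vred - P.deg mult) := by
  rw [Finset.sum_sigma']
  refine Finset.sum_bij' (fun x _ => multOf x.1 x.2)
    (fun mult _ => ⟨P.mSupport mult, fun e => mult e - 1⟩) ?_ ?_ ?_ ?_ ?_
  · rintro ⟨F, g⟩ h
    simp only [Finset.mem_sigma, Finset.mem_filter, Finset.mem_univ, true_and] at h ⊢
    rw [mem_all2, is2ERF_validR F g (validR_zero h.2).1]
    exact h
  · intro mult h
    rw [mem_all2, ← multOf_self mult, is2ERF_validR] at h
    · simp only [Finset.mem_sigma, Finset.mem_filter, Finset.mem_univ, true_and]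
      exact h
    · intro e he
      simp only [BiconedGraph.mSupport, Finset.mem_filter, Finset.mem_univ, true_and,
        not_not] at he
      omega
  · rintro ⟨F, g⟩ h
    simp only [Finset.mem_sigma, Finset.mem_filter, Finset.mem_univ, true_and] at h
    simp only [mSupport_multOf]
    congr 1
    funext e
    unfold multOf
    split_ifs with he
    · rfl
    · rw [(validR_zero h.2).1 e he]
  · intro mult h
    exact multOf_self mult
  · rintro ⟨F, g⟩ h
    simp only [Finset.mem_sigma, Finset.mem_filter, Finset.mem_univ, true_and] at h
    simp only [deg_multOf (validR_zero h.2).1]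

theorem numAcyclic_eq (i : ℕ) : P.numAcyclic i =
    ((Finset.univ.filter (fun H : Finset P.EB => IsAcyclic P.endsB H)).filter
      fun H => H.card = i).card := by
  unfold BiconedGraph.numAcyclic
  rw [Finset.filter_filter, Nat.card_eq_fintype_card, Fintype.card_subtype]

theorem card_all2 (i : ℕ) :
    Nat.card {mult : P.Ered → ℕ // P.Is2ERF mult ∧ P.deg mult = i} =
      ((all2 P).filter fun mult => P.deg mult = i).card := by
  refine Nat.subtype_card _ fun mult => ?_
  rw [Finset.mem_filter, mem_all2]

theorem final (h : ℕ → ℤ) (hh : P.IsHVector h) (i : ℕ) (hi : i ≤ P.d) :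
    h i = Nat.card {mult : P.Ered → ℕ // P.Is2ERF mult ∧ P.deg mult = i} := by
  obtain ⟨hle, htot⟩ := total_P P
  rw [sum_all2] at htot
  rw [card_vred] at hle htot
  have hle2 : ∀ mult ∈ all2 P, P.deg mult ≤ P.d := fun mult hm => by
    rw [← card_vred]
    exact deg_le (mem_all2.1 hm)
  rw [← sum_by_degree _ _ P.d (fun H hH => hle H (Finset.mem_filter.1 hH).2),
    ← sum_by_degree _ _ P.d hle2] at htot
  unfold BiconedGraph.IsHVector at hh
  simp only [numAcyclic_eq] at hh
  rw [htot] at hh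
  have hc := congrArg (fun p => Polynomial.coeff p (P.d - i)) hh
  simp only [Polynomial.finsetSum_coeff, Polynomial.coeff_C_mul, Polynomial.coeff_X_pow] at hc
  rw [Finset.sum_eq_single_of_mem i (Finset.mem_range.2 (by omega)),
    Finset.sum_eq_single_of_mem i (Finset.mem_range.2 (by omega))] at hc
  · rw [card_all2]
    simpa using hc.symm
  · intro b hb hne
    rw [Finset.mem_range] at hb
    rw [if_neg (by omega), mul_zero]
  · intro b hb hne
    rw [Finset.mem_range] at hb
    rw [if_neg (by omega), mul_zero]

end Final

/-- Let `G^{A,B}` be a biconed graph with h-vector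
`(h 0, …, h d)` of its graphic matroid.  Then for every `i`, `h i` equals the
number of 2-edge-rooted forests of `G^{A,B}_red` of degree `i`. -/
theorem hVector_eq_card_twoEdgeRootedForests (P : BiconedGraph)
    (h : ℕ → ℤ) (hh : P.IsHVector h) :
    ∀ i ≤ P.d,
      h i = Nat.card {mult : P.Ered → ℕ // P.Is2ERF mult ∧ P.deg mult = i} := by
  exact fun i hi => final h hh i hi

end

end BiconedPaper
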